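/- arXiv:2207.01027 — 12 statements merged into one kernel-verified Lean document; each statement's English description precedes it below -/
import Mathlib

section
/- Let q be a prime power, let m, n, h be positive integers with n ≥ 2 and 1 ≤ h < m, let X be an F_q-vector space of dimension mn, and let A be an m-spread of X. If U is an (A,h)-scattered F_q-subspace of X, then dim_{F_q}(U) ≤ m(n−1)+h−1. -/
open Module in
/-- If the members of a spread all meet `W` in dimension `k`, then counting the nonzero vectors of `W`
gives `#W - 1 = #A * (q ^ k - 1)`. -/
theorem card_pow_finrank_sub_one_of_spread {F X : Type*} [Field F] [Fintype F]
    [AddCommGroup X] [Module F X] [FiniteDimensional F X] {A : Set (Submodule F X)}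
    (hAint : ∀ S ∈ A, ∀ T ∈ A, S ≠ T → S ⊓ T = ⊥)
    (hAcov : ∀ x : X, x ≠ 0 → ∃ S ∈ A, x ∈ S)
    {W : Submodule F X} {k : ℕ} (hW : ∀ S ∈ A, finrank F ↥(W ⊓ S) = k) :
    Fintype.card F ^ finrank F W - 1 = A.ncard * (Fintype.card F ^ k - 1) := by
  classical
  have : Finite X := Module.finite_of_finite F
  have : Fintype X := Fintype.ofFinite X
  have : Finite (Submodule F X) := Finite.of_injective _ SetLike.coe_injective
  have hA : A.Finite := A.toFinite
  have card_ne_zero (V : Submodule F X) :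
      (Finset.univ.filter fun x : X => x ∈ V ∧ x ≠ 0).card =
        Fintype.card F ^ finrank F V - 1 := by
    rw [← Module.card_eq_pow_finrank (K := F) (V := V), Fintype.card_subtype,
      ← Finset.card_erase_of_mem (a := (0 : X)) (by simp)]
    congr 1
    ext x
    simp [and_comm]
  have hunion : (Finset.univ.filter fun x : X => x ∈ W ∧ x ≠ 0) =
      hA.toFinset.biUnion fun S => Finset.univ.filter fun x : X => x ∈ W ⊓ S ∧ x ≠ 0 := by
    ext x
    simp only [Finset.mem_filter_univ, Finset.mem_biUnion, Set.Finite.mem_toFinset,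
      Submodule.mem_inf]
    constructor
    · rintro ⟨hx, hx0⟩
      obtain ⟨S, hS, hxS⟩ := hAcov x hx0
      exact ⟨S, hS, ⟨hx, hxS⟩, hx0⟩
    · rintro ⟨S, -, ⟨hx, -⟩, hx0⟩
      exact ⟨hx, hx0⟩
  rw [← card_ne_zero, hunion, Finset.card_biUnion, Set.ncard_eq_toFinset_card A hA,
    Finset.sum_const_nat]
  · intro S hS
    rw [card_ne_zero, hW S (by simpa using hS)]
  · intro S hS T hT hST
    rw [Function.onFun, Finset.disjoint_left]
    intro x hxS hxT
    simp only [Finset.mem_filter_univ, Submodule.mem_inf] at hxS hxT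
    have hx : x ∈ S ⊓ T := ⟨hxS.1.2, hxT.1.2⟩
    rw [hAint S (by simpa using hS) T (by simpa using hT) hST] at hx
    exact hxS.2 (by simpa using hx)


/-- Let `q` be a prime power, `m, n, h` positive integers with `n ≥ 2` and
`1 ≤ h < m`, `X` an `F_q`-vector space of dimension `m*n`, and `A` an `m`-spread of `X`.
If `U` is an `(A,h)`-scattered `F_q`-subspace of `X`, then `dim U ≤ m*(n-1) + h - 1`. -/
theorem stmt_1 (q m n h : ℕ) (hq : IsPrimePow q) (hm : 0 < m) (hn : 2 ≤ n)
    (hh1 : 1 ≤ h) (hhm : h < m)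
    (F : Type) [Field F] [Fintype F] (hF : Fintype.card F = q)
    (X : Type) [AddCommGroup X] [Module F X] [FiniteDimensional F X]
    (hX : Module.finrank F X = m * n)
    (A : Set (Submodule F X))
    (hAdim : ∀ S ∈ A, Module.finrank F S = m)
    (hAint : ∀ S ∈ A, ∀ T ∈ A, S ≠ T → S ⊓ T = ⊥)
    (hAcov : ∀ x : X, x ≠ 0 → ∃ S ∈ A, x ∈ S)
    (U : Submodule F X)
    (hU : ∀ S ∈ A, Module.finrank F ↥(U ⊓ S) ≤ h) :
    Module.finrank F U ≤ m * (n - 1) + h - 1 := by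
  by_contra! hlt
  obtain ⟨e, he⟩ : ∃ e, e = m * (n - 1) := ⟨_, rfl⟩
  have he0 : e ≠ 0 := he ▸ Nat.mul_ne_zero hm.ne' (by omega)
  have hmn : m * n = m + e := by
    rw [he, ← mul_one_add m]
    congr 1
    omega
  rw [← he] at hlt
  have hinf : ∀ S ∈ A, Module.finrank F ↥(U ⊓ S) = h ∧ Module.finrank F U = e + h := by
    intro S hS
    have h1 := Submodule.finrank_sup_add_finrank_inf_eq U S
    have h2 := Submodule.finrank_le (U ⊔ S)
    have h3 := hU S hS
    rw [hAdim S hS] at h1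
    omega
  have : Nontrivial X := Module.nontrivial_of_finrank_pos (R := F) (by rw [hX, hmn]; omega)
  obtain ⟨x, hx⟩ := exists_ne (0 : X)
  obtain ⟨S, hS, -⟩ := hAcov x hx
  have hUcard := card_pow_finrank_sub_one_of_spread hAint hAcov fun S hS => (hinf S hS).1
  have hXcard := card_pow_finrank_sub_one_of_spread (W := ⊤) (k := m) hAint hAcov
    fun S hS => by rw [top_inf_eq, hAdim S hS]
  rw [(hinf S hS).2, hF] at hUcard
  rw [finrank_top, hX, hmn, hF] at hXcard
  have hq1 : 1 < q := hq.one_lt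
  have hc : 1 < q ^ e := Nat.one_lt_pow he0 hq1
  have hba : q ^ h < q ^ m := Nat.pow_lt_pow_right hq1 hhm
  have hpos (i : ℕ) : 1 ≤ q ^ i := Nat.one_le_pow _ _ (by omega)
  zify [hpos] at hUcard hXcard hc hba
  rw [pow_add] at hUcard hXcard
  have hzero : ((q : ℤ) ^ e - 1) * (q ^ m - q ^ h) = 0 := by
    linear_combination ((q : ℤ) ^ m - 1) * hUcard - ((q : ℤ) ^ h - 1) * hXcard
  exact (mul_pos (sub_pos.2 hc) (sub_pos.2 hba)).ne' hzero
end

section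
/- Let q be a prime power and let m, n, h be positive integers with n ≥ 2 and 1 ≤ h ≤ m. Let X = F_{q^m}^n, regarded as an F_q-vector space of dimension mn, and let D be its Desarguesian m-spread. Then there exist a subset A ⊆ D with |A| = q^{m(n−1)} and an F_q-subspace U of X with dim_{F_q}(U) = m(n−1)+h such that U is (A,h)-scattered. -/
/-- A finite-dimensional vector space surjects onto every coordinate space of at most its
dimension. -/
theorem exists_surjective_to_pi (K V : Type*) [Field K] [AddCommGroup V] [Module K V]
    [Module.Finite K V] {d : ℕ} (hd : d ≤ Module.finrank K V) :
    ∃ f : V →ₗ[K] (Fin d → K), Function.Surjective f :=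
  ⟨LinearMap.funLeft K K (Fin.castLE hd) ∘ₗ (Module.finBasis K V).equivFun.toLinearMap,
    (LinearMap.funLeft_surjective_of_injective K K _ (Fin.castLE_injective hd)).comp
      (Module.finBasis K V).equivFun.surjective⟩


/-- For `q` a prime power, `m, n, h` positive integers with `n ≥ 2` and
`1 ≤ h ≤ m`, and `X = F_{q^m}^n` with Desarguesian `m`-spread `D`, there exist a subset
`A ⊆ D` with `|A| = q^(m*(n-1))` and an `F_q`-subspace `U` of `X` of dimension
`m*(n-1) + h` which is `(A,h)`-scattered. -/
theorem stmt_2 (q m n h : ℕ) (hq : IsPrimePow q) (hm : 0 < m) (hn : 2 ≤ n)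
    (hh1 : 1 ≤ h) (hhm : h ≤ m)
    (F : Type) [Field F] [Fintype F] (hF : Fintype.card F = q)
    (E : Type) [Field E] [Algebra F E] (hE : Module.finrank F E = m) :
    ∃ A ⊆ {S : Submodule F (Fin n → E) | ∃ x : Fin n → E, x ≠ 0 ∧
        S = (Submodule.span E {x}).restrictScalars F},
      Set.ncard A = q ^ (m * (n - 1)) ∧
      ∃ U : Submodule F (Fin n → E),
        Module.finrank F U = m * (n - 1) + h ∧
        ∀ S ∈ A, Module.finrank F ↥(U ⊓ S) ≤ h := by
  obtain ⟨k, rfl⟩ : ∃ k, n = k + 1 := ⟨n - 1, by omega⟩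
  have : Module.Finite F E := Module.finite_of_finrank_pos (by omega)
  obtain ⟨f, hf⟩ := exists_surjective_to_pi F E (d := m - h) (by omega)
  have hker : Module.finrank F (LinearMap.ker f) = h := by
    have hr := f.finrank_range_add_finrank_ker
    rw [LinearMap.range_eq_top.2 hf, finrank_top, Module.finrank_fin_fun] at hr
    omega
  let line : (Fin k → E) → Submodule F (Fin (k + 1) → E) := fun y =>
    (Submodule.span E {(Fin.cons 1 y : Fin (k + 1) → E)}).restrictScalars F
  let p : (Fin (k + 1) → E) →ₗ[F] E := LinearMap.proj 0
  have hp : Function.Surjective p := fun a => ⟨fun _ => a, rfl⟩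
  have hfp : Function.Surjective (f ∘ₗ p) := hf.comp hp
  have hline : Function.Injective line := by
    intro y z hyz
    have hy : (Fin.cons 1 y : Fin (k + 1) → E) ∈ line z :=
      hyz ▸ Submodule.mem_span_singleton_self (R := E) (Fin.cons 1 y : Fin (k + 1) → E)
    obtain ⟨c, hc⟩ := Submodule.mem_span_singleton.1
      ((Submodule.restrictScalars_mem F _ _).1 hy)
    have hc1 : c = 1 := by simpa using congrFun hc 0
    rw [hc1, one_smul] at hc
    exact (Fin.cons_right_injective (α := fun _ => E) 1 hc).symm
  refine ⟨Set.range line, ?_, ?_, LinearMap.ker (f ∘ₗ p), ?_, ?_⟩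
  · rintro _ ⟨y, rfl⟩
    exact ⟨Fin.cons 1 y, fun h0 => by simpa using congrFun h0 0, rfl⟩
  · rw [← Set.image_univ, Set.ncard_image_of_injective _ hline, Set.ncard_univ, Nat.card_fun,
      Module.natCard_eq_pow_finrank (K := F), hE, Nat.card_eq_fintype_card, hF, ← pow_mul,
      Nat.card_eq_fintype_card, Fintype.card_fin, Nat.add_sub_cancel]
  · have hr := (f ∘ₗ p).finrank_range_add_finrank_ker
    rw [LinearMap.range_eq_top.2 hfp, finrank_top, Module.finrank_fin_fun,
      Module.finrank_pi_fintype] at hr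
    simp only [hE, Finset.sum_const, Finset.card_univ, Fintype.card_fin, smul_eq_mul] at hr
    rw [Nat.add_sub_cancel]
    have : (k + 1) * m = m * k + m := by ring
    omega
  · rintro _ ⟨y, rfl⟩
    let g : ↥(LinearMap.ker (f ∘ₗ p) ⊓ line y) →ₗ[F] LinearMap.ker f :=
      (p.domRestrict _).codRestrict _ fun v => v.2.1
    have hg : Function.Injective g := by
      rw [← LinearMap.ker_eq_bot, LinearMap.ker_eq_bot']
      rintro ⟨v, hv, hvy⟩ h0
      have hv0 : v 0 = 0 := congrArg Subtype.val h0
      obtain ⟨c, rfl⟩ := Submodule.mem_span_singleton.1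
        ((Submodule.restrictScalars_mem F _ _).1 hvy)
      have hc : c = 0 := by simpa using hv0
      exact Subtype.ext (by simp [hc])
    exact (LinearMap.finrank_le_finrank_of_injective hg).trans hker.le
end

section
/- For every prime power q and all positive integers m, n, h with n ≥ 2 and 1 ≤ h ≤ m, there exist an m-spread A of the F_q-vector space F_q^{mn} and an (A,h)-scattered F_q-subspace U of F_q^{mn} with dim_{F_q}(U) = m(n−1)+h−1. -/
open Module

/-- In an extension of a finite field `F`, the roots of `X ^ #F - X` lie in `F`. -/
lemma exists_algebraMap_eq_of_pow_card_eq_self {F K : Type*} [Field F] [Fintype F] [Field K]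
    [Finite K] [Algebra F K] {x : K} (hx : x ^ Fintype.card F = x) :
    ∃ c : F, algebraMap F K c = x := by
  have hfix : ∀ g : Gal(K/F), g x = x := by
    intro g
    obtain ⟨i, rfl⟩ := (FiniteField.bijective_frobeniusAlgEquivOfAlgebraic_pow F K).2 g
    rw [AlgEquiv.coe_pow]
    exact Function.iterate_fixed (by simpa using hx) _
  have h := (IsGalois.mem_bot_iff_fixed (F := F) x).2 hfix
  rwa [IntermediateField.mem_bot, Set.mem_range] at h

section LinearAlgebra

variable {F V W : Type*} [Field F] [AddCommGroup V] [Module F V] [AddCommGroup W] [Module F W]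

lemma Submodule.exists_finrank_eq [FiniteDimensional F V] {k : ℕ} (hk : k ≤ finrank F V) :
    ∃ H : Submodule F V, finrank F H = k := by
  obtain ⟨f, hf⟩ := exists_linearIndependent_of_le_finrank hk
  exact ⟨span F (Set.range f), by simpa using finrank_span_eq_card hf⟩

lemma Submodule.finrank_map_add_finrank_inf_ker [FiniteDimensional F V] (f : V →ₗ[F] W)
    (S : Submodule F V) :
    finrank F (S.map f) + finrank F ↥(S ⊓ LinearMap.ker f) = finrank F S := by
  have h := LinearMap.finrank_range_add_finrank_ker (f.domRestrict S)
  rw [LinearMap.range_domRestrict, LinearMap.ker_domRestrict] at h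
  rw [← h, ← Submodule.map_comap_subtype, finrank_map_subtype_eq]

lemma Submodule.finrank_comap_of_surjective [FiniteDimensional F V] {f : V →ₗ[F] W}
    (hf : Function.Surjective f) (H : Submodule F W) :
    finrank F (H.comap f) = finrank F H + finrank F (LinearMap.ker f) := by
  rw [← finrank_map_add_finrank_inf_ker f, Submodule.map_comap_eq_of_surjective hf,
    inf_eq_right.2 (LinearMap.ker_le_comap f)]

lemma Submodule.finrank_comap_inf_le [FiniteDimensional F V] [FiniteDimensional F W]
    (f : V →ₗ[F] W) (H : Submodule F W) (S : Submodule F V) :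
    finrank F ↥(H.comap f ⊓ S) ≤ finrank F H + finrank F ↥(S ⊓ LinearMap.ker f) := by
  rw [← finrank_map_add_finrank_inf_ker f]
  refine add_le_add (finrank_mono ?_) (finrank_mono ?_)
  · exact (map_mono inf_le_left).trans (map_comap_le f H)
  · exact inf_le_inf_right _ inf_le_right

end LinearAlgebra

section TwistedSpread

variable (F : Type*) {K W : Type*} [Field F] [Fintype F] [Field K] [Algebra F K]
  [AddCommGroup W] [Module F W] [Module K W] [IsScalarTower F K W]

/-- The `F`-linear map `x ↦ (x • v, b * x - x ^ #F)`. -/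
noncomputable def twistedLine (v : W) (b : K) : K →ₗ[F] W × K :=
  ((LinearMap.toSpanSingleton K W v).restrictScalars F).prod
    (LinearMap.mulLeft F b - (FiniteField.frobeniusAlgHom F K).toLinearMap)

@[simp]
lemma twistedLine_apply (v : W) (b x : K) :
    twistedLine F v b x = (x • v, b * x - x ^ Fintype.card F) := by
  simp [twistedLine]

lemma twistedLine_injective {v : W} (hv : v ≠ 0) (b : K) :
    Function.Injective (twistedLine F v b) := by
  intro x y h
  simp only [twistedLine_apply, Prod.mk.injEq] at h
  exact smul_left_injective K hv h.1

variable (K W) in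
/-- The spread obtained from the Desarguesian spread of `W × K` by replacing, in each `K`-plane
through `0 × K`, the regular spread by a Frobenius-twisted one containing `0 × K`. -/
def twistedSpread : Set (Submodule F (W × K)) :=
  insert (LinearMap.range (LinearMap.inr F W K))
    (Set.range fun i : Projectivization K W × K ↦ LinearMap.range (twistedLine F i.1.rep i.2))

lemma finrank_of_mem_twistedSpread {S : Submodule F (W × K)} (hS : S ∈ twistedSpread F K W) :
    finrank F S = finrank F K := by
  rcases hS with rfl | ⟨⟨p, b⟩, rfl⟩
  · exact LinearMap.finrank_range_of_inj LinearMap.inr_injective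
  · exact LinearMap.finrank_range_of_inj (twistedLine_injective F p.rep_nonzero b)

lemma range_inr_inf_range_twistedLine {v : W} (hv : v ≠ 0) (b : K) :
    LinearMap.range (LinearMap.inr F W K) ⊓ LinearMap.range (twistedLine F v b) = ⊥ := by
  rw [eq_bot_iff]
  rintro _ ⟨⟨y, rfl⟩, x, h⟩
  have hx : x = 0 := by
    simpa [hv] using congrArg Prod.fst h
  rw [← h, hx, map_zero]
  exact zero_mem _

lemma twistedSpread_inf_eq_bot {S T : Submodule F (W × K)} (hS : S ∈ twistedSpread F K W)
    (hT : T ∈ twistedSpread F K W) (hST : S ≠ T) : S ⊓ T = ⊥ := by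
  rcases hS with rfl | ⟨⟨p, b⟩, rfl⟩ <;> rcases hT with rfl | ⟨⟨p', b'⟩, rfl⟩
  · exact absurd rfl hST
  · exact range_inr_inf_range_twistedLine F p'.rep_nonzero b'
  · rw [inf_comm]
    exact range_inr_inf_range_twistedLine F p.rep_nonzero b
  · rw [eq_bot_iff]
    rintro _ ⟨⟨x, rfl⟩, y, h⟩
    by_contra hne
    have hx : x ≠ 0 := by
      rintro rfl
      exact hne (by simp)
    simp only [twistedLine_apply, Prod.mk.injEq] at h
    have hp : p = p' := by
      rw [← p.mk_rep, ← p'.mk_rep, Projectivization.mk_eq_mk_iff']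
      exact ⟨x⁻¹ * y, by rw [mul_smul, h.1, inv_smul_smul₀ hx]⟩
    subst hp
    have hxy : y = x := smul_left_injective K p.rep_nonzero h.1
    subst hxy
    have hb : b' = b := mul_right_cancel₀ hx (sub_left_injective h.2)
    subst hb
    exact hST rfl

lemma exists_mem_twistedSpread (z : W × K) : ∃ S ∈ twistedSpread F K W, z ∈ S := by
  obtain ⟨w, y⟩ := z
  by_cases hw : w = 0
  · exact ⟨_, Set.mem_insert _ _, y, by simp [hw]⟩
  · obtain ⟨a, ha⟩ := Projectivization.exists_smul_eq_mk_rep K w hw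
    refine ⟨_, Set.mem_insert_of_mem _
      ⟨(Projectivization.mk K w hw, (y + (a : K)⁻¹ ^ Fintype.card F) * a), rfl⟩, (a : K)⁻¹, ?_⟩
    rw [twistedLine_apply, ← ha, Units.smul_def, inv_smul_smul₀ a.ne_zero,
      mul_inv_cancel_right₀ a.ne_zero, add_sub_cancel_right]

/-- `W × 0` is scattered with respect to the twisted spread. -/
lemma finrank_twistedSpread_inf_ker_snd_le_one [Finite K] {S : Submodule F (W × K)}
    (hS : S ∈ twistedSpread F K W) :
    finrank F ↥(S ⊓ LinearMap.ker (LinearMap.snd F W K)) ≤ 1 := by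
  rcases hS with rfl | ⟨⟨p, b⟩, rfl⟩
  · have h : LinearMap.range (LinearMap.inr F W K) ⊓ LinearMap.ker (LinearMap.snd F W K) = ⊥ := by
      rw [eq_bot_iff]
      rintro _ ⟨⟨y, rfl⟩, h⟩
      simpa using h
    rw [h, finrank_bot]
    exact zero_le_one
  · by_cases hex : ∃ x : K, x ≠ 0 ∧ b * x = x ^ Fintype.card F
    · obtain ⟨x, hx, hbx⟩ := hex
      refine finrank_le_one ⟨twistedLine F p.rep b x, ⟨x, rfl⟩, by simp [hbx]⟩ ?_
      rintro ⟨_, ⟨y, rfl⟩, hy⟩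
      have hby : b * y = y ^ Fintype.card F := by simpa [sub_eq_zero] using hy
      have hpow : (y / x) ^ Fintype.card F = y / x := by
        by_cases hb : b = 0
        · exact absurd (hbx.symm.trans (by simp [hb])) (pow_ne_zero _ hx)
        · rw [div_pow, ← hby, ← hbx, mul_div_mul_left _ _ hb]
      obtain ⟨c, hc⟩ := exists_algebraMap_eq_of_pow_card_eq_self hpow
      refine ⟨c, Subtype.ext ?_⟩
      change c • twistedLine F p.rep b x = twistedLine F p.rep b y
      rw [← map_smul, Algebra.smul_def, hc, div_mul_cancel₀ _ hx]
    · push Not at hex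
      have h : LinearMap.range (twistedLine F p.rep b) ⊓
          LinearMap.ker (LinearMap.snd F W K) = ⊥ := by
        rw [eq_bot_iff]
        rintro _ ⟨⟨y, rfl⟩, hy⟩
        have hby : b * y = y ^ Fintype.card F := by simpa [sub_eq_zero] using hy
        have hy0 : y = 0 := by
          by_contra hy0
          exact hex y hy0 hby
        simp [hy0]
      rw [h, finrank_bot]
      exact zero_le_one

end TwistedSpread

/-- For every prime power `q` and all positive integers `m, n, h` with
`n ≥ 2` and `1 ≤ h ≤ m`, there exist an `m`-spread `A` of `F_q^(m*n)` and an
`(A,h)`-scattered `F_q`-subspace `U` of `F_q^(m*n)` of dimension `m*(n-1) + h - 1`. -/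
theorem stmt_4 (q m n h : ℕ) (hq : IsPrimePow q) (hm : 0 < m) (hn : 2 ≤ n)
    (hh1 : 1 ≤ h) (hhm : h ≤ m)
    (F : Type) [Field F] [Fintype F] (hF : Fintype.card F = q) :
    ∃ A : Set (Submodule F (Fin (m * n) → F)),
      ((∀ S ∈ A, Module.finrank F S = m) ∧
        (∀ S ∈ A, ∀ T ∈ A, S ≠ T → S ⊓ T = ⊥) ∧
        (∀ x : Fin (m * n) → F, x ≠ 0 → ∃ S ∈ A, x ∈ S)) ∧
      ∃ U : Submodule F (Fin (m * n) → F),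
        Module.finrank F U = m * (n - 1) + h - 1 ∧
        ∀ S ∈ A, Module.finrank F ↥(U ⊓ S) ≤ h := by
  obtain ⟨p, _⟩ := CharP.exists F
  have : Fact p.Prime := ⟨CharP.char_is_prime F p⟩
  have : NeZero m := ⟨hm.ne'⟩
  let K := FiniteField.Extension F p m
  let W := Fin (n - 1) → K
  have hK : finrank F K = m := FiniteField.finrank_extension F p m
  have hW : finrank F W = m * (n - 1) := by
    rw [finrank_pi_fintype]
    simp [hK, mul_comm]
  have hV : finrank F (W × K) = finrank F (Fin (m * n) → F) := by
    rw [finrank_prod, hW, hK, finrank_fin_fun, ← Nat.mul_succ]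
    congr 1
    omega
  let e : (W × K) ≃ₗ[F] (Fin (m * n) → F) := LinearEquiv.ofFinrankEq _ _ hV
  obtain ⟨H, hH⟩ := Submodule.exists_finrank_eq (F := F) (V := K) (k := h - 1) (by omega)
  have hker : finrank F (LinearMap.ker (LinearMap.snd F W K)) = m * (n - 1) := by
    rw [LinearMap.ker_snd, LinearMap.finrank_range_of_inj LinearMap.inl_injective, hW]
  refine ⟨Submodule.map e.toLinearMap '' twistedSpread F K W, ⟨?_, ?_, ?_⟩,
    (H.comap (LinearMap.snd F W K)).map e.toLinearMap, ?_, ?_⟩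
  · rintro _ ⟨S, hS, rfl⟩
    rw [LinearEquiv.finrank_map_eq, finrank_of_mem_twistedSpread F hS, hK]
  · rintro _ ⟨S, hS, rfl⟩ _ ⟨T, hT, rfl⟩ hST
    rw [← Submodule.map_inf _ e.injective,
      twistedSpread_inf_eq_bot F hS hT (fun h ↦ hST (h ▸ rfl)), Submodule.map_bot]
  · intro x _
    obtain ⟨S, hS, hx⟩ := exists_mem_twistedSpread F (e.symm x)
    exact ⟨_, ⟨S, hS, rfl⟩, e.symm x, hx, e.apply_symm_apply x⟩
  · rw [LinearEquiv.finrank_map_eq,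
      Submodule.finrank_comap_of_surjective LinearMap.snd_surjective, hH, hker]
    omega
  · rintro _ ⟨S, hS, rfl⟩
    rw [← Submodule.map_inf _ e.injective, LinearEquiv.finrank_map_eq]
    have h₁ := Submodule.finrank_comap_inf_le (LinearMap.snd F W K) H S
    have h₂ := finrank_twistedSpread_inf_ker_snd_le_one F hS
    omega
end

section
/- Let q be a prime power, let m, n, s, k be positive integers, let h be an integer with 1 ≤ h < m, and let X = F_{q^m}^n, regarded as an F_q-vector space of dimension mn. Let v_1, …, v_s ∈ X \ {0} be vectors whose F_{q^m}-spans ⟨v_1⟩_{F_{q^m}}, …, ⟨v_s⟩_{F_{q^m}} are pairwise distinct, and let A^{(2)} = {⟨u⟩_{F_{q^m}} : u ∈ X \ {0} and u ∈ ⟨v_i, v_j⟩_{F_{q^m}} for some i, j ∈ {1,…,s}}. Suppose k ≤ mn−m+h and there exists an (A^{(2)},h)-scattered F_q-subspace U of X with dim_{F_q}(U) = k. Then s(q^m−1)+1 ≤ q^{(mn−k)(h+1)} if k ≤ mn−m, and s(q^m−1)+1 ≤ q^{m(mn−k−m+h+1)} if k > mn−m. -/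
open Module

/-- Every subspace is contained in one of any larger admissible dimension. -/
theorem exists_le_finrank_eq {K V : Type*} [Field K] [AddCommGroup V] [Module K V]
    [FiniteDimensional K V] (U : Submodule K V) {d : ℕ} (hd : finrank K U + d ≤ finrank K V) :
    ∃ W : Submodule K V, U ≤ W ∧ finrank K W = finrank K U + d := by
  obtain ⟨C, hC⟩ := U.exists_isCompl
  have hdC : d ≤ finrank K C := by
    have := Submodule.finrank_add_eq_of_isCompl hC
    omega
  obtain ⟨b, hb⟩ := exists_linearIndependent_of_le_finrank hdC
  have hb' : LinearIndependent K fun t => (b t : V) := hb.map' C.subtype C.ker_subtype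
  have hle : Submodule.span K (Set.range fun t => (b t : V)) ≤ C := by
    rw [Submodule.span_le]
    rintro _ ⟨t, rfl⟩
    exact (b t).2
  refine ⟨U ⊔ Submodule.span K (Set.range fun t => (b t : V)), le_sup_left, ?_⟩
  have h := Submodule.finrank_sup_add_finrank_inf_eq U
    (Submodule.span K (Set.range fun t => (b t : V)))
  rw [(hC.disjoint.mono_right hle).eq_bot, finrank_bot, finrank_span_eq_card hb',
    Fintype.card_fin] at h
  omega

/-- Nonzero multiples of pairwise non-proportional vectors, together with zero, are counted by the
target of any additive map that does not vanish on the nonzero vectors of the spans of two of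
them. -/
theorem card_mul_card_sub_one_add_one_le {E X Y ι : Type*} [Field E] [Finite E] [Fintype ι]
    [Nonempty ι] [AddCommGroup X] [Module E X] [AddCommGroup Y] [Finite Y] (v : ι → X)
    (hv0 : ∀ i, v i ≠ 0) (hv : Function.Injective fun i => Submodule.span E {v i})
    (T : X →+ Y)
    (hT : ∀ u : X, u ≠ 0 → (∃ i j, u ∈ Submodule.span E {v i, v j}) → T u ≠ 0) :
    Fintype.card ι * (Nat.card E - 1) + 1 ≤ Nat.card Y := by
  let f : Option (ι × Eˣ) → X := fun a => a.elim 0 fun p => p.2 • v p.1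
  have hf : Function.Injective f := by
    have hne : ∀ p : ι × Eˣ, p.2 • v p.1 ≠ 0 := fun p => by
      simpa [Units.smul_def] using hv0 p.1
    rintro (_ | p) (_ | p') h
    · rfl
    · exact absurd h.symm (hne p')
    · exact absurd h (hne p)
    · obtain ⟨i, c⟩ := p
      obtain ⟨j, d⟩ := p'
      have h' : c • v i = d • v j := h
      have hij : i = j := hv <| by
        change Submodule.span E {v i} = Submodule.span E {v j}
        rw [← Submodule.span_singleton_group_smul_eq E c, h',
          Submodule.span_singleton_group_smul_eq]
      subst hij
      have hcd : (c : E) = d := smul_left_injective E (hv0 i) h'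
      rw [Units.ext hcd]
  have hmem : ∀ a, ∃ i, f a ∈ Submodule.span E {v i} := by
    rintro (_ | p)
    · exact ⟨Classical.arbitrary ι, zero_mem _⟩
    · exact ⟨p.1, Submodule.smul_mem _ (p.2 : E) (Submodule.mem_span_singleton_self _)⟩
  have hTf : Function.Injective fun a => T (f a) := by
    intro a b hab
    by_contra hne
    obtain ⟨i, hi⟩ := hmem a
    obtain ⟨j, hj⟩ := hmem b
    refine hT (f a - f b) (sub_ne_zero.2 fun h => hne (hf h)) ⟨i, j, sub_mem ?_ ?_⟩ ?_
    · exact Submodule.span_mono (by simp) hi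
    · exact Submodule.span_mono (by simp) hj
    · rw [map_sub, sub_eq_zero]
      exact hab
  have := Nat.card_le_card_of_injective _ hTf
  rwa [Finite.card_option, Nat.card_prod, Nat.card_units, Nat.card_eq_fintype_card (α := ι)] at this

/-- The counting bound for the map sending `u` to the classes modulo `W` of the multiples of `u`
by a given finite family of scalars. -/
theorem card_mul_card_sub_one_add_one_le_pow {F E X ι : Type*} [Field F] [Finite F] [Field E]
    [Finite E] [Algebra F E] [Fintype ι] [Nonempty ι] [AddCommGroup X] [Module E X] [Module F X]
    [IsScalarTower F E X] [FiniteDimensional F X] (v : ι → X)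
    (hv0 : ∀ i, v i ≠ 0) (hv : Function.Injective fun i => Submodule.span E {v i})
    (W : Submodule F X) {a : ℕ} (b : Fin a → E)
    (hW : ∀ u : X, u ≠ 0 → (∃ i j, u ∈ Submodule.span E {v i, v j}) → ¬ ∀ t, b t • u ∈ W) :
    Fintype.card ι * (Nat.card E - 1) + 1 ≤ Nat.card F ^ ((finrank F X - finrank F W) * a) := by
  have : Finite (X ⧸ W) := Module.finite_of_finite F
  let T : X →+ (Fin a → X ⧸ W) := AddMonoidHom.mk' (fun u t => W.mkQ (b t • u)) fun x y => by
    ext t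
    simp [smul_add]
  refine (card_mul_card_sub_one_add_one_le v hv0 hv T fun u hu h hTu =>
    hW u hu h fun t => ?_).trans_eq ?_
  · have := congrFun hTu t
    exact (Submodule.Quotient.mk_eq_zero W).1 this
  · rw [Nat.card_fun, Nat.card_fin, Module.natCard_eq_pow_finrank (K := F), ← pow_mul,
      Submodule.finrank_quotient]

/-- Bound on the size of a partial Desarguesian spread admitting an
`(A^(2),h)`-scattered subspace of dimension `k`:
`s(q^m-1)+1 ≤ q^((mn-k)(h+1))` if `k ≤ mn-m`, and
`s(q^m-1)+1 ≤ q^(m(mn-k-m+h+1))` otherwise. -/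
theorem stmt_6 (q m n s k h : ℕ) (hq : IsPrimePow q) (hm : 0 < m) (hn : 0 < n)
    (hs : 0 < s) (hk : 0 < k) (hh1 : 1 ≤ h) (hhm : h < m)
    (hk' : k ≤ m * n - m + h)
    (F : Type) [Field F] [Fintype F] (hF : Fintype.card F = q)
    (E : Type) [Field E] [Algebra F E] (hE : Module.finrank F E = m)
    (v : Fin s → (Fin n → E)) (hv0 : ∀ i, v i ≠ 0)
    (hvdist : Function.Injective fun i => Submodule.span E {v i})
    (U : Submodule F (Fin n → E)) (hUk : Module.finrank F U = k)
    (hUsc : ∀ u : Fin n → E, u ≠ 0 →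
      (∃ i j : Fin s, u ∈ Submodule.span E {v i, v j}) →
      Module.finrank F ↥(U ⊓ (Submodule.span E {u}).restrictScalars F) ≤ h) :
    (k ≤ m * n - m → s * (q ^ m - 1) + 1 ≤ q ^ ((m * n - k) * (h + 1))) ∧
    (m * n - m < k → s * (q ^ m - 1) + 1 ≤ q ^ (m * (m * n + h + 1 - (k + m)))) := by
  have hmpos : 0 < finrank F E := hE ▸ hm
  have : FiniteDimensional F E := FiniteDimensional.of_finrank_pos hmpos
  have : Finite E := Module.finite_of_finite F
  have : Nonempty (Fin s) := ⟨⟨0, hs⟩⟩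
  have hcardF : Nat.card F = q := by rw [Nat.card_eq_fintype_card, hF]
  have hcardE : Nat.card E = q ^ m := by
    rw [Module.natCard_eq_pow_finrank (K := F), hcardF, hE]
  have hX : finrank F (Fin n → E) = m * n := by
    rw [Module.finrank_pi_fintype]
    simp [hE, mul_comm]
  have hmn : m ≤ m * n := Nat.le_mul_of_pos_right m hn
  have hinj : ∀ u : Fin n → E, u ≠ 0 →
      LinearMap.ker ((LinearMap.toSpanSingleton E (Fin n → E) u).restrictScalars F) = ⊥ := by
    intro u hu
    rw [LinearMap.ker_eq_bot]
    exact smul_left_injective E hu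
  refine ⟨fun _ => ?_, fun hlt => ?_⟩
  · obtain ⟨b, hb⟩ := exists_linearIndependent_of_le_finrank (R := F) (M := E) (n := h + 1)
      (by omega)
    have key := card_mul_card_sub_one_add_one_le_pow (F := F) v hv0 hvdist U b
      fun u hu hspan hall => by
        have hbu : LinearIndependent F fun t => b t • u := hb.map' _ (hinj u hu)
        have hle : Submodule.span F (Set.range fun t => b t • u) ≤
            U ⊓ (Submodule.span E {u}).restrictScalars F := by
          rw [Submodule.span_le]
          rintro _ ⟨t, rfl⟩
          exact ⟨hall t, Submodule.smul_mem _ _ (Submodule.mem_span_singleton_self u)⟩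
        have h1 := Submodule.finrank_mono hle
        rw [finrank_span_eq_card hbu, Fintype.card_fin] at h1
        have h2 := hUsc u hu hspan
        omega
    rwa [hcardE, hcardF, hX, hUk, Fintype.card_fin] at key
  · obtain ⟨W, hUW, hW⟩ := exists_le_finrank_eq U (d := m - h - 1) (by rw [hX, hUk]; omega)
    have key := card_mul_card_sub_one_add_one_le_pow (F := F) v hv0 hvdist W
      (finBasisOfFinrankEq F E hE) fun u hu hspan hall => by
        let g := (LinearMap.toSpanSingleton E (Fin n → E) u).restrictScalars F
        have hrange : LinearMap.range g = (Submodule.span E {u}).restrictScalars F := by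
          ext x
          simp [g, Submodule.mem_span_singleton]
        have hle : (Submodule.span E {u}).restrictScalars F ≤ W := by
          rw [← hrange, ← Submodule.map_top, ← (finBasisOfFinrankEq F E hE).span_eq,
            Submodule.map_span_le]
          rintro _ ⟨t, rfl⟩
          exact hall t
        have h1 := Submodule.finrank_mono (sup_le hUW hle)
        have h2 := Submodule.finrank_sup_add_finrank_inf_eq U
          ((Submodule.span E {u}).restrictScalars F)
        have h3 : finrank F ((Submodule.span E {u}).restrictScalars F) = m := by
          rw [← hrange, LinearMap.finrank_range_of_inj (LinearMap.ker_eq_bot.1 (hinj u hu)), hE]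
        have h4 := hUsc u hu hspan
        omega
    rw [hcardE, hcardF, hX, hW, hUk, Fintype.card_fin, mul_comm _ m] at key
    rwa [show m * n + h + 1 - (k + m) = m * n - (k + (m - h - 1)) by omega]
end

section
/- Let q be a prime power, let m, n, ℓ, h be positive integers, let X = F_{q^m}^n, and let D = {⟨x⟩_{F_{q^m}} : x ∈ X \ {0}} be the Desarguesian m-spread of X. Suppose X = X_1 ⊕ … ⊕ X_ℓ, where each X_i is an F_{q^m}-subspace of X of F_{q^m}-dimension d_i ≥ 2. If for every i ∈ {1,…,ℓ} the F_q-subspace U_i ≤ X_i is (D,h)-scattered, then U = U_1 ⊕ … ⊕ U_ℓ is a (D,h)-scattered F_q-subspace of X. -/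
/-- If `X = F_{q^m}^n = X_1 ⊕ ... ⊕ X_ℓ` with each `X_i` an
`F_{q^m}`-subspace of dimension `d_i ≥ 2`, and each `U_i ≤ X_i` is `(D,h)`-scattered
with respect to the Desarguesian `m`-spread `D` of `X`, then `U = U_1 ⊕ ... ⊕ U_ℓ` is
`(D,h)`-scattered. -/
theorem stmt_7 (q m n L h : ℕ) (hq : IsPrimePow q) (hm : 0 < m) (hn : 0 < n)
    (hL : 0 < L) (hh : 0 < h)
    (F : Type) [Field F] [Fintype F] (hF : Fintype.card F = q)
    (E : Type) [Field E] [Algebra F E] (hE : Module.finrank F E = m)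
    (Xs : Fin L → Submodule E (Fin n → E))
    (hX : DirectSum.IsInternal Xs)
    (d : Fin L → ℕ) (hd : ∀ i, Module.finrank E (Xs i) = d i)
    (hd2 : ∀ i, 2 ≤ d i)
    (U : Fin L → Submodule F (Fin n → E))
    (hUle : ∀ i, U i ≤ (Xs i).restrictScalars F)
    (hUsc : ∀ i, ∀ x : Fin n → E, x ≠ 0 →
      Module.finrank F ↥(U i ⊓ (Submodule.span E {x}).restrictScalars F) ≤ h) :
    ∀ x : Fin n → E, x ≠ 0 →
      Module.finrank F ↥((⨆ i, U i) ⊓ (Submodule.span E {x}).restrictScalars F) ≤ h := by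
  intro x hx
  classical
  have : FiniteDimensional F E := FiniteDimensional.of_finrank_pos (hE ▸ hm)
  let e := LinearEquiv.ofBijective (DirectSum.coeLinearMap Xs) hX
  have hxe : e.symm x ≠ 0 := by simpa using hx
  obtain ⟨i, hi⟩ : ∃ i, e.symm x i ≠ 0 := by
    by_contra! hzero
    exact hxe (DFinsupp.ext hzero)
  let P : (Fin n → E) →ₗ[E] (Fin n → E) :=
    (Xs i).subtype ∘ₗ DirectSum.component E (Fin L) (fun j => Xs j) i ∘ₗ e.symm.toLinearMap
  have hPapply (y : Fin n → E) : P y = (e.symm y i : Fin n → E) := rfl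
  have hPx : P x ≠ 0 := by
    rw [hPapply]
    simpa using hi
  have hsymm (j : Fin L) (y : Xs j) : e.symm y = DirectSum.lof E (Fin L) (fun j => Xs j) j y := by
    rw [LinearEquiv.symm_apply_eq]
    exact (DirectSum.coeLinearMap_lof Xs j y).symm
  have hPU : (⨆ j, U j) ≤ (U i).comap (P.restrictScalars F) := by
    refine iSup_le fun j y hy => ?_
    rw [Submodule.mem_comap, LinearMap.restrictScalars_apply, hPapply,
      hsymm j ⟨y, hUle j hy⟩, DirectSum.lof_eq_of]
    by_cases hji : j = i
    · subst hji
      simpa only [DirectSum.of_eq_same] using hy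
    · rw [DirectSum.of_eq_of_ne _ _ _ (Ne.symm hji)]
      exact zero_mem _
  have hmaps : ∀ y ∈ (⨆ j, U j) ⊓ (Submodule.span E {x}).restrictScalars F,
      P.restrictScalars F y ∈ U i ⊓ (Submodule.span E {P x}).restrictScalars F := by
    rintro y ⟨hyU, hyx⟩
    refine ⟨hPU hyU, ?_⟩
    obtain ⟨c, rfl⟩ := Submodule.mem_span_singleton.mp hyx
    exact Submodule.mem_span_singleton.mpr ⟨c, (P.map_smul c x).symm⟩
  refine le_trans (LinearMap.finrank_le_finrank_of_injective
    (f := (P.restrictScalars F).restrict hmaps) ?_) (hUsc i (P x) hPx)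
  rw [← LinearMap.ker_eq_bot, LinearMap.ker_eq_bot']
  rintro ⟨y, hyU, hyx⟩ hy
  obtain ⟨c, rfl⟩ := Submodule.mem_span_singleton.mp hyx
  have hcP : c • P x = 0 := by
    rw [← P.map_smul]
    exact congrArg Subtype.val hy
  have hc : c = 0 := (smul_eq_zero.mp hcP).resolve_right hPx
  ext1
  simp [hc]
end

section
/- Let q be a prime power, let m, h, t_1, t_2 be positive integers, set n = t_1 + t_2, and let X = F_{q^m}^n, regarded as an F_q-vector space of dimension mn. Let T_1 and T_2 be F_{q^m}-subspaces of X of F_{q^m}-dimensions t_1 and t_2 respectively with X = T_1 ⊕ T_2, and let A = {⟨v⟩_{F_{q^m}} : v ∈ X \ T_2}. Suppose (h+1) divides h·m·t_1 and there exists an (A,h)-scattered F_q-subspace U_1 of T_1 with dim_{F_q}(U_1) = h·m·t_1/(h+1). Then U = U_1 ⊕ T_2 is an (A,h)-scattered F_q-subspace of X with dim_{F_q}(U) = (h·m·n + m·t_2)/(h+1). -/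
/-- Let `X = F_{q^m}^n = T_1 ⊕ T_2` with `dim_{F_{q^m}} T_i = t_i`,
`n = t_1 + t_2`, and `A = {⟨v⟩_{F_{q^m}} : v ∉ T_2}`. If `U_1 ≤ T_1` is an
`(A,h)`-scattered `F_q`-subspace of dimension `h·m·t_1/(h+1)`, then `U = U_1 ⊕ T_2`
is an `(A,h)`-scattered `F_q`-subspace of dimension `(h·m·n + m·t_2)/(h+1)`. -/
theorem stmt_8 (q m h t1 t2 : ℕ) (hq : IsPrimePow q) (hm : 0 < m) (hh : 0 < h)
    (ht1 : 0 < t1) (ht2 : 0 < t2)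
    (F : Type) [Field F] [Fintype F] (hF : Fintype.card F = q)
    (E : Type) [Field E] [Algebra F E] (hE : Module.finrank F E = m)
    (T1 T2 : Submodule E (Fin (t1 + t2) → E))
    (hT1 : Module.finrank E T1 = t1) (hT2 : Module.finrank E T2 = t2)
    (hdisj : T1 ⊓ T2 = ⊥) (hsup : T1 ⊔ T2 = ⊤)
    (hdvd : (h + 1) ∣ h * m * t1)
    (U1 : Submodule F (Fin (t1 + t2) → E))
    (hU1le : U1 ≤ T1.restrictScalars F)
    (hU1dim : Module.finrank F U1 = h * m * t1 / (h + 1))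
    (hU1sc : ∀ v : Fin (t1 + t2) → E, v ∉ T2 →
      Module.finrank F ↥(U1 ⊓ (Submodule.span E {v}).restrictScalars F) ≤ h) :
    (∀ v : Fin (t1 + t2) → E, v ∉ T2 →
      Module.finrank F
        ↥((U1 ⊔ T2.restrictScalars F) ⊓ (Submodule.span E {v}).restrictScalars F) ≤ h) ∧
    Module.finrank F ↥(U1 ⊔ T2.restrictScalars F) =
      (h * m * (t1 + t2) + m * t2) / (h + 1) := by
  have hcompl : IsCompl T1 T2 := IsCompl.of_eq hdisj hsup
  have : FiniteDimensional F E := Module.finite_of_finrank_pos (hE ▸ hm)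
  have : FiniteDimensional F (Fin (t1 + t2) → E) := inferInstance
  refine ⟨fun v hv => ?_, ?_⟩
  · set P : (Fin (t1 + t2) → E) →ₗ[E] (Fin (t1 + t2) → E) := T1.projection T2 hcompl
    have hker : ∀ x, P x = 0 ↔ x ∈ T2 := fun x => Submodule.projection_apply_eq_zero_iff hcompl
    have hfix : ∀ x ∈ T1, P x = x := fun x hx => Submodule.projection_apply_of_mem_left hcompl hx
    have hPv : P v ∉ T2 := by
      intro hmem
      have hPT1 : P v ∈ T1 := Submodule.projection_apply_mem hcompl v
      have h0 : P v ∈ T1 ⊓ T2 := ⟨hPT1, hmem⟩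
      rw [hdisj, Submodule.mem_bot] at h0
      exact hv ((hker v).1 h0)
    refine le_trans ?_ (hU1sc (P v) hPv)
    have hmaps : ∀ x ∈ (U1 ⊔ T2.restrictScalars F) ⊓
        (Submodule.span E {v}).restrictScalars F,
        P.restrictScalars F x ∈ U1 ⊓ (Submodule.span E {P v}).restrictScalars F := by
      rintro x ⟨hxU, hxv⟩
      refine ⟨?_, ?_⟩
      · obtain ⟨u, hu, w, hw, rfl⟩ := Submodule.mem_sup.1 hxU
        have h1 : P u = u := hfix u (hU1le hu)
        have h2 : P w = 0 := (hker w).2 hw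
        simpa [h1, h2] using hu
      · obtain ⟨c, rfl⟩ := Submodule.mem_span_singleton.1 hxv
        exact Submodule.mem_span_singleton.2 ⟨c, (map_smul P c v).symm⟩
    refine LinearMap.finrank_le_finrank_of_injective
      (f := (P.restrictScalars F).restrict hmaps) ?_
    rw [← LinearMap.ker_eq_bot, LinearMap.ker_eq_bot']
    rintro ⟨x, hxU, hxv⟩ hx
    obtain ⟨c, rfl⟩ := Submodule.mem_span_singleton.1 hxv
    have h0 : P (c • v) = 0 := congrArg Subtype.val hx
    have hmem : c • v ∈ T2 := (hker _).1 h0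
    have hc : c = 0 := by
      by_contra hc
      exact hv ((T2.smul_mem_iff hc).1 hmem)
    simp [hc]
  · have hinf : U1 ⊓ T2.restrictScalars F = ⊥ := by
      rw [eq_bot_iff]
      rintro x ⟨hx1, hx2⟩
      have h0 : x ∈ T1 ⊓ T2 := ⟨hU1le hx1, hx2⟩
      rwa [hdisj] at h0
    have hsum := Submodule.finrank_sup_add_finrank_inf_eq U1 (T2.restrictScalars F)
    have hT2F : Module.finrank F (T2.restrictScalars F) = m * t2 := by
      have := Module.finrank_mul_finrank F E T2
      rw [hE, hT2] at this
      exact this.symm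
    rw [hinf, finrank_bot, add_zero, hU1dim, hT2F] at hsum
    rw [hsum, show h * m * (t1 + t2) + m * t2 = h * m * t1 + m * t2 * (h + 1) by ring,
      Nat.add_mul_div_right _ _ h.succ_pos]
end

section
/- Let q be a prime power and let N, k, m, h be integers with 1 ≤ k ≤ N, 1 ≤ m ≤ N−k and 0 ≤ h ≤ m−1, and let A be an m-dimensional F_q-subspace of F_q^N. Then the number of k-dimensional F_q-subspaces U of F_q^N with dim_{F_q}(U ∩ A) ≥ h+1 equals ∂_q(N,k,m,h) = Σ_{ℓ=h+1}^{m} Σ_{b=ℓ}^{m} [m choose ℓ]_q [m−ℓ choose b−ℓ]_q [N−b choose k−b]_q (−1)^{b−ℓ} q^{(b−ℓ)(b−ℓ−1)/2} (an identity of integers). -/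
/-- The Gaussian binomial coefficient `[a choose b]_q`, defined via the `q`-Pascal
recursion `[a+1 choose b+1]_q = [a choose b]_q + q^(b+1) [a choose b+1]_q`; it equals
the number of `b`-dimensional `F_q`-subspaces of `F_q^a` (and is `0` for `b > a`). -/
def gaussBinomNat (q : ℕ) : ℕ → ℕ → ℕ
  | _, 0 => 1
  | 0, _ + 1 => 0
  | a + 1, b + 1 => gaussBinomNat q a b + q ^ (b + 1) * gaussBinomNat q a (b + 1)

/-- The Gaussian binomial coefficient with integer indices, with the convention that it
vanishes when `b < 0` or `b > a`. -/
def gaussBinom (q : ℕ) (a b : ℤ) : ℤ :=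
  if 0 ≤ b ∧ b ≤ a then gaussBinomNat q a.toNat b.toNat else 0

/-- The quantity `∂_q(N,k,m,h)` of Lemma 5.8. -/
def partialDelta (q N k m h : ℕ) : ℤ :=
  ∑ l ∈ Finset.Icc (h + 1) m, ∑ b ∈ Finset.Icc l m,
    gaussBinom q m l * gaussBinom q ((m : ℤ) - l) ((b : ℤ) - l) *
      gaussBinom q ((N : ℤ) - b) ((k : ℤ) - b) * (-1) ^ (b - l) *
      (q : ℤ) ^ ((b - l) * (b - l - 1) / 2)

section GaussianBinomials

variable (q : ℕ)

@[simp]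
theorem gaussBinomNat_zero_right (a : ℕ) : gaussBinomNat q a 0 = 1 := by
  cases a <;> rfl

theorem gaussBinomNat_succ_succ (a b : ℕ) :
    gaussBinomNat q (a + 1) (b + 1) =
      gaussBinomNat q a b + q ^ (b + 1) * gaussBinomNat q a (b + 1) :=
  rfl

theorem gaussBinomNat_eq_zero_of_lt {a b : ℕ} (hab : a < b) : gaussBinomNat q a b = 0 := by
  induction a generalizing b with
  | zero =>
    obtain ⟨b, rfl⟩ := Nat.exists_eq_succ_of_ne_zero hab.ne'
    rfl
  | succ a ih =>
    obtain ⟨b, rfl⟩ := Nat.exists_eq_succ_of_ne_zero (Nat.ne_zero_of_lt hab)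
    rw [Nat.succ_eq_add_one, gaussBinomNat_succ_succ, ih (by omega), ih (by omega)]
    simp

@[simp]
theorem gaussBinomNat_self (a : ℕ) : gaussBinomNat q a a = 1 := by
  induction a with
  | zero => rfl
  | succ a ih =>
    rw [gaussBinomNat_succ_succ, ih, gaussBinomNat_eq_zero_of_lt q (Nat.lt_succ_self a), mul_zero, add_zero]

theorem gaussBinom_sub_sub {a b c : ℕ} (hca : c ≤ a) (hcb : c ≤ b) :
    gaussBinom q ((a : ℤ) - c) ((b : ℤ) - c) = gaussBinomNat q (a - c) (b - c) := by
  rw [← Nat.cast_sub hca, ← Nat.cast_sub hcb, gaussBinom]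
  split_ifs with hab
  · simp
  · rw [gaussBinomNat_eq_zero_of_lt q (by omega), Nat.cast_zero]

theorem gaussBinom_natCast (a b : ℕ) : gaussBinom q a b = gaussBinomNat q a b := by
  simpa using gaussBinom_sub_sub q (Nat.zero_le a) (Nat.zero_le b)

/-- The `q`-factorial, without the normalising factor `(q - 1) ^ n`. -/
def qFactorial (n : ℕ) : ℤ := ∏ i ∈ Finset.range n, ((q : ℤ) ^ (i + 1) - 1)

theorem qFactorial_succ (n : ℕ) :
    qFactorial q (n + 1) = qFactorial q n * ((q : ℤ) ^ (n + 1) - 1) :=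
  Finset.prod_range_succ _ _

theorem qFactorial_ne_zero {q : ℕ} (hq : 1 < q) (n : ℕ) : qFactorial q n ≠ 0 := by
  refine Finset.prod_ne_zero_iff.2 fun i _ ↦ sub_ne_zero.2 ?_
  exact (one_lt_pow₀ (by exact_mod_cast hq) i.succ_ne_zero).ne'

theorem gaussBinomNat_add_mul_qFactorial (a b : ℕ) :
    (gaussBinomNat q (a + b) a : ℤ) * qFactorial q a * qFactorial q b = qFactorial q (a + b) := by
  induction a generalizing b with
  | zero => simp [qFactorial]
  | succ a iha =>
    induction b with
    | zero => simp [qFactorial]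
    | succ b ihb =>
      have ha := iha (b + 1)
      have e : a + 1 + b = a + (b + 1) := by ring
      rw [e] at ihb
      rw [show a + 1 + (b + 1) = a + (b + 1) + 1 by ring, gaussBinomNat_succ_succ,
        qFactorial_succ q (a + (b + 1))]
      rw [qFactorial_succ] at ihb ha ⊢
      rw [qFactorial_succ q b]
      push_cast
      linear_combination ((q : ℤ) ^ (a + 1) - 1) * ha +
        (q : ℤ) ^ (a + 1) * ((q : ℤ) ^ (b + 1) - 1) * ihb

theorem gaussBinomNat_mul_gaussBinomNat {q : ℕ} (hq : 1 < q) (n : ℕ) {b l : ℕ} (hlb : l ≤ b) :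
    gaussBinomNat q n b * gaussBinomNat q b l =
      gaussBinomNat q n l * gaussBinomNat q (n - l) (b - l) := by
  rcases lt_or_ge n b with hnb | hbn
  · rw [gaussBinomNat_eq_zero_of_lt q hnb, zero_mul, eq_comm, mul_eq_zero]
    rcases lt_or_ge n l with hnl | hln
    · exact Or.inl (gaussBinomNat_eq_zero_of_lt q hnl)
    · exact Or.inr (gaussBinomNat_eq_zero_of_lt q (by omega))
  · obtain ⟨j, rfl⟩ := Nat.exists_eq_add_of_le hlb
    obtain ⟨r, rfl⟩ := Nat.exists_eq_add_of_le hbn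
    have h₁ := gaussBinomNat_add_mul_qFactorial q (l + j) r
    have h₂ := gaussBinomNat_add_mul_qFactorial q l j
    have h₃ := gaussBinomNat_add_mul_qFactorial q l (j + r)
    have h₄ := gaussBinomNat_add_mul_qFactorial q j r
    rw [show l + j + r - l = j + r by omega, show l + j - l = j by omega]
    rw [← add_assoc] at h₃
    have hne : qFactorial q l * qFactorial q j * qFactorial q r ≠ 0 :=
      mul_ne_zero (mul_ne_zero (qFactorial_ne_zero hq l) (qFactorial_ne_zero hq j))
        (qFactorial_ne_zero hq r)
    have : (gaussBinomNat q (l + j + r) (l + j) : ℤ) * gaussBinomNat q (l + j) l =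
        gaussBinomNat q (l + j + r) l * gaussBinomNat q (j + r) j := by
      apply mul_right_cancel₀ hne
      linear_combination gaussBinomNat q (l + j + r) (l + j) * qFactorial q r * h₂ + h₁ -
        gaussBinomNat q (l + j + r) l * qFactorial q l * h₄ - h₃
    exact_mod_cast this

theorem sum_range_neg_one_pow_mul_gaussBinomNat_succ (n M : ℕ) :
    ∑ j ∈ Finset.range (M + 1),
        (-1 : ℤ) ^ j * (q : ℤ) ^ j.choose 2 * gaussBinomNat q (n + 1) j =
      (-1) ^ M * (q : ℤ) ^ (M + 1).choose 2 * gaussBinomNat q n M := by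
  induction M with
  | zero => simp
  | succ M ih =>
    rw [Finset.sum_range_succ, ih, gaussBinomNat_succ_succ, Nat.choose_succ_succ' (M + 1) 1,
      Nat.choose_one_right]
    push_cast
    ring

theorem sum_range_neg_one_pow_mul_gaussBinomNat {n M : ℕ} (hnM : n < M) :
    ∑ j ∈ Finset.range M, (-1 : ℤ) ^ j * (q : ℤ) ^ j.choose 2 * gaussBinomNat q n j =
      if n = 0 then 1 else 0 := by
  obtain ⟨M, rfl⟩ := Nat.exists_eq_succ_of_ne_zero (Nat.ne_zero_of_lt hnM)
  cases n with
  | zero =>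
    rw [Finset.sum_eq_single_of_mem 0 (by simp)]
    · simp
    · intro j _ hj
      rw [gaussBinomNat_eq_zero_of_lt q (Nat.pos_of_ne_zero hj), Nat.cast_zero, mul_zero]
  | succ n =>
    rw [Nat.succ_eq_add_one, sum_range_neg_one_pow_mul_gaussBinomNat_succ,
      gaussBinomNat_eq_zero_of_lt q (by omega)]
    simp

/-- Inversion of the lower triangular matrix of Gaussian binomial coefficients. -/
theorem sum_Icc_gaussBinomNat_inversion {q : ℕ} (hq : 1 < q) {d l m : ℕ} (hdm : d ≤ m)
    (hlm : l ≤ m) :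
    ∑ b ∈ Finset.Icc l m, (gaussBinomNat q d b : ℤ) * gaussBinomNat q b l *
        ((-1) ^ (b - l) * (q : ℤ) ^ (b - l).choose 2) =
      if d = l then 1 else 0 := by
  have key : ∀ b ∈ Finset.Icc l m, (gaussBinomNat q d b : ℤ) * gaussBinomNat q b l *
      ((-1) ^ (b - l) * (q : ℤ) ^ (b - l).choose 2) = gaussBinomNat q d l *
      ((-1) ^ (b - l) * (q : ℤ) ^ (b - l).choose 2 * gaussBinomNat q (d - l) (b - l)) := by
    intro b hb
    rw [← Nat.cast_mul, gaussBinomNat_mul_gaussBinomNat hq d (Finset.mem_Icc.1 hb).1]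
    push_cast
    ring
  rw [Finset.sum_congr rfl key, ← Finset.mul_sum, ← Finset.Ico_add_one_right_eq_Icc,
    Finset.sum_Ico_eq_sum_range]
  simp only [Nat.add_sub_cancel_left]
  rw [sum_range_neg_one_pow_mul_gaussBinomNat q (by omega)]
  rcases lt_trichotomy d l with h | rfl | h
  · simp [gaussBinomNat_eq_zero_of_lt q h, h.ne]
  · simp
  · simp [h.ne', Nat.sub_ne_zero_of_lt h]

theorem gaussBinomNat_mul_prod (n k : ℕ) :
    (gaussBinomNat q n k : ℤ) * ∏ i ∈ Finset.range k, ((q : ℤ) ^ k - (q : ℤ) ^ i) =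
      ∏ i ∈ Finset.range k, ((q : ℤ) ^ n - (q : ℤ) ^ i) := by
  have hsucc (a b : ℕ) : ∏ i ∈ Finset.range (b + 1), ((q : ℤ) ^ (a + 1) - (q : ℤ) ^ i) =
      ((q : ℤ) ^ (a + 1) - 1) * (q : ℤ) ^ b *
        ∏ i ∈ Finset.range b, ((q : ℤ) ^ a - (q : ℤ) ^ i) := by
    rw [Finset.prod_range_succ', pow_zero, mul_comm, mul_assoc, ← Finset.card_range b,
      ← Finset.prod_const, Finset.card_range, ← Finset.prod_mul_distrib]
    congr 1
    exact Finset.prod_congr rfl fun i _ ↦ by ring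
  induction n generalizing k with
  | zero =>
    cases k with
    | zero => simp
    | succ k =>
      rw [gaussBinomNat_eq_zero_of_lt q k.succ_pos, Nat.cast_zero, zero_mul, eq_comm]
      exact Finset.prod_eq_zero (Finset.mem_range.2 k.succ_pos) (by simp)
  | succ n ih =>
    cases k with
    | zero => simp
    | succ k =>
      have h₁ := ih k
      have h₂ := ih (k + 1)
      rw [hsucc, Finset.prod_range_succ] at h₂
      rw [gaussBinomNat_succ_succ, hsucc, hsucc]
      push_cast
      linear_combination (q : ℤ) ^ k * ((q : ℤ) ^ (k + 1) - 1) * h₁ + (q : ℤ) ^ (k + 1) * h₂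

end GaussianBinomials

section SubspaceCounting

open Module

theorem finrank_comap_mkQ {F V : Type*} [Field F] [AddCommGroup V] [Module F V]
    [FiniteDimensional F V] (B : Submodule F V) (p : Submodule F (V ⧸ B)) :
    finrank F (p.comap B.mkQ) = finrank F p + finrank F B := by
  have h := LinearMap.finrank_range_add_finrank_ker (p.mkQ ∘ₗ B.mkQ)
  rw [LinearMap.range_comp, B.range_mkQ, Submodule.map_top, p.range_mkQ, LinearMap.ker_comp,
    p.ker_mkQ, finrank_top] at h
  have h₁ := p.finrank_quotient_add_finrank
  have h₂ := B.finrank_quotient_add_finrank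
  omega

variable {F V : Type*} [Field F] [Fintype F] [AddCommGroup V] [Module F V] [Finite V]

/-- The linearly independent families spanning a given `k`-dimensional subspace `W` are the
linearly independent families of length `k` in `W`. -/
def linearIndependentSpanEquiv {k : ℕ} (W : Submodule F V) (hW : finrank F W = k) :
    {s : {s : Fin k → V // LinearIndependent F s} // Submodule.span F (Set.range s.1) = W} ≃
      {t : Fin k → W // LinearIndependent F t} where
  toFun s := ⟨fun i ↦ ⟨s.1.1 i, s.2.le (Submodule.subset_span (Set.mem_range_self i))⟩,
    LinearIndependent.of_comp W.subtype s.1.2⟩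
  invFun t := ⟨⟨fun i ↦ t.1 i, t.2.map' W.subtype W.ker_subtype⟩, by
    refine Submodule.eq_of_le_of_finrank_eq (Submodule.span_le.2 ?_) ?_
    · rintro _ ⟨i, rfl⟩
      exact (t.1 i).2
    · rw [hW]
      exact (finrank_span_eq_card (t.2.map' W.subtype W.ker_subtype)).trans (Fintype.card_fin k)⟩
  left_inv _ := rfl
  right_inv _ := rfl

theorem natCast_card_linearIndependent {k : ℕ} (hk : k ≤ finrank F V) :
    (Nat.card {s : Fin k → V // LinearIndependent F s} : ℤ) =
      ∏ i ∈ Finset.range k, ((Fintype.card F : ℤ) ^ finrank F V - (Fintype.card F : ℤ) ^ i) := by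
  rw [card_linearIndependent hk, Finset.prod_range, Nat.cast_prod]
  refine Finset.prod_congr rfl fun i _ ↦ ?_
  rw [Nat.cast_sub (Nat.pow_le_pow_right Fintype.card_pos (by omega))]
  push_cast
  rfl

/-- The Gaussian binomial coefficient counts subspaces. -/
theorem card_submodule_finrank_eq (k : ℕ) :
    Nat.card {W : Submodule F V // finrank F W = k} =
      gaussBinomNat (Fintype.card F) (finrank F V) k := by
  classical
  have : Fintype V := Fintype.ofFinite V
  have : Fintype {W : Submodule F V // finrank F W = k} := Fintype.ofFinite _
  rcases lt_or_ge (finrank F V) k with hk | hk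
  · rw [gaussBinomNat_eq_zero_of_lt _ hk, Nat.card_eq_zero]
    exact Or.inl ⟨fun W ↦ (W.2 ▸ hk).not_ge (Submodule.finrank_le W.1)⟩
  have hspan (s : {s : Fin k → V // LinearIndependent F s}) :
      finrank F (Submodule.span F (Set.range s.1)) = k :=
    (finrank_span_eq_card s.2).trans (Fintype.card_fin k)
  let f (s : {s : Fin k → V // LinearIndependent F s}) : {W : Submodule F V // finrank F W = k} :=
    ⟨Submodule.span F (Set.range s.1), hspan s⟩
  have hfib (W : {W : Submodule F V // finrank F W = k}) : (Nat.card {s // f s = W} : ℤ) =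
      ∏ i ∈ Finset.range k, ((Fintype.card F : ℤ) ^ k - (Fintype.card F : ℤ) ^ i) := by
    rw [Nat.card_congr ((Equiv.subtypeEquivRight fun s ↦ Subtype.ext_iff).trans
      (linearIndependentSpanEquiv W.1 W.2)), natCast_card_linearIndependent W.2.ge, W.2]
  have hcard := natCast_card_linearIndependent (F := F) (V := V) hk
  rw [← Nat.card_congr (Equiv.sigmaFiberEquiv f), Nat.card_sigma, Nat.cast_sum,
    Finset.sum_congr rfl fun W _ ↦ hfib W, Finset.sum_const, nsmul_eq_mul, Finset.card_univ,
    ← Nat.card_eq_fintype_card, ← gaussBinomNat_mul_prod _ (finrank F V)] at hcard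
  have hne : ∏ i ∈ Finset.range k, ((Fintype.card F : ℤ) ^ k - (Fintype.card F : ℤ) ^ i) ≠ 0 := by
    refine Finset.prod_ne_zero_iff.2 fun i hi ↦ sub_ne_zero.2 ?_
    exact (pow_lt_pow_right₀ (by exact_mod_cast Fintype.one_lt_card) (Finset.mem_range.1 hi)).ne'
  exact_mod_cast mul_right_cancel₀ hne hcard

theorem card_submodule_le_finrank_eq (W : Submodule F V) (b : ℕ) :
    Nat.card {B : Submodule F V // B ≤ W ∧ finrank F B = b} =
      gaussBinomNat (Fintype.card F) (finrank F W) b := by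
  rw [← card_submodule_finrank_eq]
  refine (Nat.card_congr ?_).symm
  refine (Equiv.subtypeEquiv (q := fun B : Set.Iic W ↦ finrank F B.1 = b) W.mapIic.toEquiv
    fun B ↦ ?_).trans (Equiv.subtypeSubtypeEquivSubtypeInter (· ≤ W) (finrank F · = b))
  exact iff_of_eq (congrArg (· = b) (Submodule.finrank_map_subtype_eq W B).symm)

theorem card_submodule_ge_finrank_eq (B : Submodule F V) {k : ℕ} (hk : finrank F B ≤ k) :
    Nat.card {U : Submodule F V // B ≤ U ∧ finrank F U = k} =
      gaussBinomNat (Fintype.card F) (finrank F V - finrank F B) (k - finrank F B) := by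
  have : Finite (V ⧸ B) := Finite.of_surjective B.mkQ B.mkQ_surjective
  rw [← B.finrank_quotient, ← card_submodule_finrank_eq]
  refine (Nat.card_congr ?_).symm
  refine (Equiv.subtypeEquiv (q := fun U : Set.Ici B ↦ finrank F U.1 = k)
    (Submodule.comapMkQRelIso B).toEquiv fun p ↦ ?_).trans
      (Equiv.subtypeSubtypeEquivSubtypeInter (B ≤ ·) (finrank F · = k))
  have : finrank F ((Submodule.comapMkQRelIso B).toEquiv p).1 = finrank F p + finrank F B :=
    finrank_comap_mkQ B p
  omega

open Classical in
/-- Double counting of the pairs `(B, U)` with `B ≤ U ⊓ A`, `dim B = b` and `dim U = k`. -/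
theorem sum_gaussBinomNat_finrank_inf [Fintype (Submodule F V)] (A : Submodule F V) (k b : ℕ)
    (hb : b ≤ finrank F V) :
    ∑ U ∈ ({U | finrank F U = k} : Finset (Submodule F V)),
        (gaussBinomNat (Fintype.card F) (finrank F ↥(U ⊓ A)) b : ℤ) =
      gaussBinomNat (Fintype.card F) (finrank F A) b *
        gaussBinom (Fintype.card F) ((finrank F V : ℤ) - b) ((k : ℤ) - b) := by
  have hdouble := Finset.sum_card_bipartiteAbove_eq_sum_card_bipartiteBelow
    (s := {U : Submodule F V | finrank F U = k})
    (t := {B : Submodule F V | B ≤ A ∧ finrank F B = b}) (fun U B ↦ B ≤ U)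
  have habove (U : Submodule F V) :
      ((({B : Submodule F V | B ≤ A ∧ finrank F B = b} : Finset _)).bipartiteAbove
        (fun U B ↦ B ≤ U) U).card = gaussBinomNat (Fintype.card F) (finrank F ↥(U ⊓ A)) b := by
    rw [← card_submodule_le_finrank_eq, Nat.card_eq_fintype_card, Fintype.card_subtype,
      Finset.bipartiteAbove, Finset.filter_filter]
    congr 1
    ext B
    simp only [Finset.mem_filter, le_inf_iff]
    tauto
  have hbelow (B : Submodule F V) (hB : finrank F B = b) :
      (((({U : Submodule F V | finrank F U = k} : Finset _)).bipartiteBelow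
        (fun U B ↦ B ≤ U) B).card : ℤ) =
      gaussBinom (Fintype.card F) ((finrank F V : ℤ) - b) ((k : ℤ) - b) := by
    have hset : ((({U : Submodule F V | finrank F U = k} : Finset _)).bipartiteBelow
        (fun U B ↦ B ≤ U) B).card = Nat.card {U : Submodule F V // B ≤ U ∧ finrank F U = k} := by
      rw [Nat.card_eq_fintype_card, Fintype.card_subtype, Finset.bipartiteBelow,
        Finset.filter_filter]
      simp only [and_comm]
    rw [hset]
    rcases le_or_gt b k with hbk | hkb
    · rw [card_submodule_ge_finrank_eq B (hB ▸ hbk), hB, gaussBinom_sub_sub _ hb hbk]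
    · rw [gaussBinom, if_neg (by omega), Nat.cast_eq_zero, Nat.card_eq_zero]
      refine Or.inl ⟨fun U ↦ ?_⟩
      have := Submodule.finrank_mono U.2.1
      omega
  rw [Finset.sum_congr rfl fun U _ ↦ habove U] at hdouble
  rw [← Nat.cast_sum, hdouble, Nat.cast_sum,
    Finset.sum_congr rfl fun B hB ↦ hbelow B (Finset.mem_filter.1 hB).2.2, Finset.sum_const,
    nsmul_eq_mul, ← card_submodule_le_finrank_eq, Nat.card_eq_fintype_card, Fintype.card_subtype]

end SubspaceCounting

/-- For `1 ≤ k ≤ N`, `1 ≤ m ≤ N-k`, `0 ≤ h ≤ m-1` and `A` an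
`m`-dimensional subspace of `F_q^N`, the number of `k`-dimensional subspaces `U` of
`F_q^N` with `dim(U ∩ A) ≥ h+1` equals `∂_q(N,k,m,h)`. -/
theorem stmt_9 (q N k m h : ℕ) (hq : IsPrimePow q)
    (hk1 : 1 ≤ k) (hkN : k ≤ N) (hm1 : 1 ≤ m) (hm : m ≤ N - k) (hh : h ≤ m - 1)
    (F : Type) [Field F] [Fintype F] (hF : Fintype.card F = q)
    (A : Submodule F (Fin N → F)) (hA : Module.finrank F A = m) :
    (Nat.card {U : Submodule F (Fin N → F) //
        Module.finrank F U = k ∧ h + 1 ≤ Module.finrank F ↥(U ⊓ A)} : ℤ) =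
      partialDelta q N k m h := by
  classical
  have : Fintype (Submodule F (Fin N → F)) := Fintype.ofFinite _
  subst hF
  set q := Fintype.card F
  have hV : Module.finrank F (Fin N → F) = N := Module.finrank_fin_fun F
  have hterm : ∀ l ∈ Finset.Icc (h + 1) m, ∀ b ∈ Finset.Icc l m,
      gaussBinom q m l * gaussBinom q ((m : ℤ) - l) ((b : ℤ) - l) *
        gaussBinom q ((N : ℤ) - b) ((k : ℤ) - b) * (-1) ^ (b - l) *
        (q : ℤ) ^ ((b - l) * (b - l - 1) / 2) =
      ∑ U ∈ ({U | Module.finrank F U = k} : Finset (Submodule F (Fin N → F))),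
        (gaussBinomNat q (Module.finrank F ↥(U ⊓ A)) b : ℤ) * gaussBinomNat q b l *
          ((-1) ^ (b - l) * (q : ℤ) ^ (b - l).choose 2) := by
    intro l hl b hb
    rw [Finset.mem_Icc] at hl hb
    have hmul : (gaussBinomNat q m b * gaussBinomNat q b l : ℤ) =
        gaussBinomNat q m l * gaussBinomNat q (m - l) (b - l) := by
      exact_mod_cast gaussBinomNat_mul_gaussBinomNat hq.one_lt m hb.1
    rw [← Finset.sum_mul, ← Finset.sum_mul,
      sum_gaussBinomNat_finrank_inf A k b (by omega), hV, hA, gaussBinom_natCast,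
      gaussBinom_sub_sub q hl.2 hb.1, Nat.choose_two_right, ← hmul]
    ring
  have hinv : ∀ U : Submodule F (Fin N → F), ∑ l ∈ Finset.Icc (h + 1) m, ∑ b ∈ Finset.Icc l m,
      (gaussBinomNat q (Module.finrank F ↥(U ⊓ A)) b : ℤ) * gaussBinomNat q b l *
        ((-1) ^ (b - l) * (q : ℤ) ^ (b - l).choose 2) =
      if h + 1 ≤ Module.finrank F ↥(U ⊓ A) then 1 else 0 := by
    intro U
    have hd : Module.finrank F ↥(U ⊓ A) ≤ m := hA ▸ Submodule.finrank_mono inf_le_right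
    rw [Finset.sum_congr rfl fun l hl ↦
      sum_Icc_gaussBinomNat_inversion hq.one_lt hd (Finset.mem_Icc.1 hl).2, Finset.sum_ite_eq]
    simp [hd]
  rw [partialDelta, Finset.sum_congr rfl fun l hl ↦
    (Finset.sum_congr rfl (hterm l hl)).trans Finset.sum_comm, Finset.sum_comm,
    Finset.sum_congr rfl fun U _ ↦ hinv U, Finset.sum_boole, Finset.filter_filter,
    Nat.card_eq_fintype_card, Fintype.card_subtype]
end

section
/- Let q be a prime power, let N, m, h be positive integers with m dividing N and 1 ≤ h ≤ m−1, suppose q^{h+1} ≥ 64, and let A be an m-spread of F_q^N. Then for every positive integer k with (h+1)k ≤ hN + m − (h+1)(m−h) (equivalently, k ≤ hN/(h+1) + m/(h+1) − m + h), there exists a k-dimensional (A,h)-scattered F_q-subspace of F_q^N. -/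
open Finset Module

/-- A linearly independent family `t` imposes `n * dim W` independent conditions on linear maps
into `W`. -/
theorem card_linearMap_vanishing_mul {F V W : Type*} [Field F] [Fintype F]
    [AddCommGroup V] [Module F V] [AddCommGroup W] [Module F W]
    [FiniteDimensional F V] [FiniteDimensional F W] {n : ℕ} {t : Fin n → V}
    (ht : LinearIndependent F t) :
    Nat.card {f : V →ₗ[F] W // ∀ i, f (t i) = 0} * Fintype.card F ^ (n * finrank F W) =
      Nat.card (V →ₗ[F] W) := by
  classical
  let L : (V →ₗ[F] W) →ₗ[F] (Fin n → W) := LinearMap.pi fun i => LinearMap.applyₗ (t i)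
  have hsurj : Function.Surjective L := by
    intro g
    obtain ⟨s, hs⟩ := LinearMap.exists_leftInverse_of_injective
      (Finsupp.linearCombination F t) (LinearMap.ker_eq_bot.2 ht)
    refine ⟨Finsupp.linearCombination F g ∘ₗ s, funext fun i => ?_⟩
    have h1 : s (t i) = Finsupp.single i 1 := by
      simpa using LinearMap.congr_fun hs (Finsupp.single i 1)
    simp [L, h1]
  have hrank := LinearMap.finrank_range_add_finrank_ker L
  rw [LinearMap.range_eq_top.2 hsurj, finrank_top, finrank_pi_fintype] at hrank
  simp only [sum_const, card_univ, Fintype.card_fin, smul_eq_mul] at hrank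
  have hker : Nat.card {f : V →ₗ[F] W // ∀ i, f (t i) = 0} = Nat.card (LinearMap.ker L) :=
    Nat.card_congr (Equiv.subtypeEquivRight fun f => by
      rw [LinearMap.mem_ker, funext_iff]; rfl)
  rw [hker, Module.natCard_eq_pow_finrank (K := F) (V := LinearMap.ker L),
    Module.natCard_eq_pow_finrank (K := F) (V := V →ₗ[F] W), Nat.card_eq_fintype_card,
    ← pow_add, ← hrank, add_comm]

/-- At least a quarter of the `n`-tuples in an `n`-dimensional space are bases. -/
theorem pow_sq_le_four_mul_prod_pow_sub_pow {q : ℕ} (hq : 2 ≤ q) (n : ℕ) :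
    q ^ (n * n) ≤ 4 * ∏ i : Fin n, (q ^ n - q ^ (i : ℕ)) := by
  have hq0 : (0 : ℚ) < q := by positivity
  set x : ℚ := (q : ℚ)⁻¹ with hx
  have hx0 : 0 < x := inv_pos.2 hq0
  have hx2 : x ≤ 1 / 2 := by
    rw [hx, one_div]; exact inv_anti₀ (by norm_num) (by exact_mod_cast hq)
  have hle : ∀ j, x ^ j ≤ 1 := fun j => pow_le_one₀ hx0.le (by linarith)
  have key : ∀ n : ℕ,
      1 - x - x ^ 2 + x ^ (n + 2) ≤ ∏ i ∈ range (n + 1), (1 - x ^ (i + 1)) := by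
    intro n
    induction n with
    | zero => simp
    | succ n ih =>
      rw [prod_range_succ]
      refine le_trans ?_ (mul_le_mul_of_nonneg_right ih (sub_nonneg.2 (hle _)))
      have h1 : 0 ≤ x ^ (n + 2) * (x ^ 2 * (1 - x ^ n)) := by
        have := sub_nonneg.2 (hle n)
        positivity
      have e : (1 - x - x ^ 2 + x ^ (n + 2)) * (1 - x ^ (n + 1 + 1)) -
          (1 - x - x ^ 2 + x ^ (n + 1 + 2)) = x ^ (n + 2) * (x ^ 2 * (1 - x ^ n)) := by ring
      linarith
  have quarter : (1 : ℚ) / 4 ≤ ∏ i ∈ range n, (1 - x ^ (i + 1)) := by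
    cases n with
    | zero => norm_num
    | succ n =>
      refine le_trans ?_ (key n)
      have : 0 < x ^ (n + 2) := by positivity
      nlinarith
  have hprod : ((∏ i : Fin n, (q ^ n - q ^ (i : ℕ)) : ℕ) : ℚ) =
      (q : ℚ) ^ (n * n) * ∏ i ∈ range n, (1 - x ^ (i + 1)) := by
    rw [Fin.prod_univ_eq_prod_range (fun i => q ^ n - q ^ i), ← prod_range_reflect,
      Nat.cast_prod, pow_mul]
    have hconst : ((q : ℚ) ^ n) ^ n = ∏ _i ∈ range n, (q : ℚ) ^ n := by simp
    rw [hconst, ← prod_mul_distrib]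
    refine prod_congr rfl fun i hi => ?_
    have hi := mem_range.1 hi
    rw [Nat.cast_sub (Nat.pow_le_pow_right (by omega) (by omega))]
    push_cast
    have e : (q : ℚ) ^ n = (q : ℚ) ^ (n - 1 - i) * (q : ℚ) ^ (i + 1) := by
      rw [← pow_add]; congr 1; omega
    have e2 : (q : ℚ) ^ (i + 1) * x ^ (i + 1) = 1 := by
      rw [← mul_pow, hx, mul_inv_cancel₀ hq0.ne', one_pow]
    rw [mul_sub, mul_one, e, mul_assoc, e2, mul_one]
  have : (q : ℚ) ^ (n * n) ≤ 4 * ((∏ i : Fin n, (q ^ n - q ^ (i : ℕ)) : ℕ) : ℚ) := by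
    rw [hprod]
    have : (0 : ℚ) < (q : ℚ) ^ (n * n) := by positivity
    nlinarith
  exact_mod_cast this

/-- The size of a partial `m`-spread: its members have disjoint sets of nonzero vectors. -/
theorem card_partialSpread_mul_le {F V : Type*} [Field F] [Fintype F]
    [AddCommGroup V] [Module F V] [FiniteDimensional F V] {m : ℕ}
    (A : Finset (Submodule F V)) (hAdim : ∀ S ∈ A, finrank F S = m)
    (hAint : ∀ S ∈ A, ∀ T ∈ A, S ≠ T → S ⊓ T = ⊥) :
    #A * (Fintype.card F ^ m - 1) ≤ Fintype.card F ^ finrank F V := by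
  classical
  have : Finite V := Module.finite_of_finite F
  have := Fintype.ofFinite V
  have hdisj : (A : Set (Submodule F V)).PairwiseDisjoint
      fun S => ({x ∈ (univ : Finset V) | x ∈ S}).erase 0 := by
    intro S hS T hT hne
    refine Finset.disjoint_left.2 fun x hxS hxT => ?_
    simp only [mem_erase, mem_filter, mem_univ, true_and] at hxS hxT
    have : x ∈ S ⊓ T := ⟨hxS.2, hxT.2⟩
    rw [hAint S hS T hT hne] at this
    exact hxS.1 ((Submodule.mem_bot F).1 this)
  have hcard : ∀ S ∈ A, #(({x ∈ (univ : Finset V) | x ∈ S}).erase 0) =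
      Fintype.card F ^ m - 1 := by
    intro S hS
    rw [card_erase_of_mem (by simp), ← Fintype.card_subtype, ← Nat.card_eq_fintype_card,
      ← hAdim S hS, ← Nat.card_eq_fintype_card (α := F)]
    congr 1
    exact Module.natCard_eq_pow_finrank (K := F) (V := S)
  rw [← sum_const_nat hcard, ← card_biUnion hdisj, ← Module.card_eq_pow_finrank]
  exact card_le_univ _

/-- Averaging: if the members of `A` carry too few `n`-tuples, some linear map `V → W` has a
kernel meeting each member of `A` in dimension less than `n`. -/
theorem exists_linearMap_finrank_ker_inf_lt {F V W : Type*} [Field F] [Fintype F]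
    [AddCommGroup V] [Module F V] [AddCommGroup W] [Module F W]
    [FiniteDimensional F V] [FiniteDimensional F W] {m n : ℕ}
    (A : Finset (Submodule F V)) (hAdim : ∀ S ∈ A, finrank F S = m)
    (hlt : #A * (Fintype.card F ^ m) ^ n <
      (∏ i : Fin n, (Fintype.card F ^ n - Fintype.card F ^ (i : ℕ))) *
        Fintype.card F ^ (n * finrank F W)) :
    ∃ f : V →ₗ[F] W, ∀ S ∈ A, finrank F ↥(LinearMap.ker f ⊓ S) < n := by
  classical
  have : Finite V := Module.finite_of_finite F
  have : Finite W := Module.finite_of_finite F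
  have : Finite (V →ₗ[F] W) := Module.finite_of_finite F
  have := Fintype.ofFinite V
  have := Fintype.ofFinite (V →ₗ[F] W)
  by_contra! hbad
  set q := Fintype.card F
  have hq0 : 0 < q := Fintype.card_pos
  set G := ∏ i : Fin n, (q ^ n - q ^ (i : ℕ))
  let P : Finset (Fin n → V) :=
    {t | LinearIndependent F t ∧ ∃ S ∈ A, ∀ i, t i ∈ S}
  let c := Nat.card (V →ₗ[F] W) / q ^ (n * finrank F W)
  have hfib : ∀ t ∈ P, #{f : V →ₗ[F] W | ∀ i, f (t i) = 0} = c := by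
    intro t ht
    have h := card_linearMap_vanishing_mul (W := W) (mem_filter.1 ht).2.1
    rw [Nat.card_eq_fintype_card, Fintype.card_subtype] at h
    exact (Nat.div_eq_of_eq_mul_left (by positivity) h.symm).symm
  have hbases : ∀ f : V →ₗ[F] W, G ≤ #{t ∈ P | ∀ i, f (t i) = 0} := by
    intro f
    obtain ⟨S, hS, hn⟩ := hbad f
    have hcard := card_linearIndependent (K := F) (V := ↥(LinearMap.ker f ⊓ S)) hn
    calc G ≤ ∏ i : Fin n, (q ^ finrank F ↥(LinearMap.ker f ⊓ S) - q ^ (i : ℕ)) :=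
          prod_le_prod' fun i _ => Nat.sub_le_sub_right (Nat.pow_le_pow_right hq0 hn) _
      _ = Nat.card {s : Fin n → ↥(LinearMap.ker f ⊓ S) // LinearIndependent F s} := hcard.symm
      _ ≤ Nat.card ↥({t ∈ P | ∀ i, f (t i) = 0} : Finset (Fin n → V)) := by
          refine Nat.card_le_card_of_injective
            (fun s => ⟨fun i => (s.1 i : V), ?_⟩) ?_
          · simp only [P, mem_filter, mem_univ, true_and]
            refine ⟨⟨?_, S, hS, fun i => (s.1 i).2.2⟩, fun i => (s.1 i).2.1⟩
            exact s.2.map' (Submodule.subtype _) (Submodule.ker_subtype _)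
          · intro s s' h
            refine Subtype.ext (funext fun i => Subtype.ext ?_)
            exact congr_fun (Subtype.ext_iff.1 h) i
      _ = _ := Nat.card_eq_finsetCard _
  have hP : #P ≤ #A * (q ^ m) ^ n := by
    have hsub : P ⊆ A.biUnion fun S => {t : Fin n → V | ∀ i, t i ∈ S} := by
      intro t ht
      obtain ⟨S, hS, h⟩ := (mem_filter.1 ht).2.2
      exact mem_biUnion.2 ⟨S, hS, by simpa using h⟩
    refine (card_le_card hsub).trans (card_biUnion_le_card_mul _ _ _ fun S hS => ?_)
    have e : ({t : Fin n → V | ∀ i, t i ∈ S} : Finset (Fin n → V)) =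
        Fintype.piFinset fun _ => {x : V | x ∈ S} := by
      ext t; simp
    have hS' : #{x : V | x ∈ S} = q ^ m := by
      rw [← Fintype.card_subtype, ← Nat.card_eq_fintype_card, ← hAdim S hS]
      exact (Module.natCard_eq_pow_finrank (K := F) (V := S)).trans
        (by rw [Nat.card_eq_fintype_card])
    rw [e, Fintype.card_piFinset]
    simp [hS']
  have hcount : #(univ : Finset (V →ₗ[F] W)) * G ≤ #P * c :=
    card_mul_le_card_mul (fun (f : V →ₗ[F] W) (t : Fin n → V) => ∀ i, f (t i) = 0)
      (fun f _ => hbases f)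
      fun t ht => (hfib t ht).le
  rw [card_univ, ← Nat.card_eq_fintype_card] at hcount
  have hcq : c * q ^ (n * finrank F W) ≤ Nat.card (V →ₗ[F] W) := Nat.div_mul_le_self _ _
  have hpos : 0 < Nat.card (V →ₗ[F] W) := Nat.card_pos
  have : Nat.card (V →ₗ[F] W) * (G * q ^ (n * finrank F W)) ≤
      Nat.card (V →ₗ[F] W) * (#A * (q ^ m) ^ n) :=
    calc _ = Nat.card (V →ₗ[F] W) * G * q ^ (n * finrank F W) := by ring
      _ ≤ #P * c * q ^ (n * finrank F W) := Nat.mul_le_mul_right _ hcount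
      _ = #P * (c * q ^ (n * finrank F W)) := by ring
      _ ≤ #A * (q ^ m) ^ n * Nat.card (V →ₗ[F] W) := Nat.mul_le_mul hP hcq
      _ = _ := by ring
  exact hlt.not_ge (Nat.le_of_mul_le_mul_left this hpos)

/-- Let `m ∣ N`, `1 ≤ h ≤ m-1`, `q^(h+1) ≥ 64`, and let `A` be an
`m`-spread of `F_q^N`. Then for every positive integer `k` with
`(h+1)k ≤ hN + m − (h+1)(m−h)` there exists a `k`-dimensional `(A,h)`-scattered
`F_q`-subspace of `F_q^N`. -/
theorem stmt_12 (q N m h : ℕ) (hq : IsPrimePow q) (hN : 0 < N) (hm : 0 < m)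
    (hdvd : m ∣ N) (hh1 : 1 ≤ h) (hhm : h ≤ m - 1) (h64 : 64 ≤ q ^ (h + 1))
    (F : Type) [Field F] [Fintype F] (hF : Fintype.card F = q)
    (A : Set (Submodule F (Fin N → F)))
    (hAdim : ∀ S ∈ A, Module.finrank F S = m)
    (hAint : ∀ S ∈ A, ∀ T ∈ A, S ≠ T → S ⊓ T = ⊥)
    (hAcov : ∀ x : Fin N → F, x ≠ 0 → ∃ S ∈ A, x ∈ S) :
    ∀ k : ℕ, 0 < k → (h + 1) * k ≤ h * N + m - (h + 1) * (m - h) →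
      ∃ U : Submodule F (Fin N → F), Module.finrank F U = k ∧
        ∀ S ∈ A, Module.finrank F ↥(U ⊓ S) ≤ h := by
  classical
  intro k hk hkN
  set n := h + 1 with hn
  have hq2 : 2 ≤ q := hq.two_le
  have hmN : m ≤ N := Nat.le_of_dvd hN hdvd
  obtain ⟨d, rfl⟩ : ∃ d, m = h + d := ⟨m - h, by omega⟩
  have hd : 1 ≤ d := by omega
  have hnk : n * k + n * d ≤ h * N + (h + d) := by
    rw [Nat.add_sub_cancel_left] at hkN
    have : 0 < n * k := by positivity
    omega
  have hkN' : k ≤ N := by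
    have : n * k ≤ n * N := by
      have : n * N = h * N + N := by rw [hn]; ring
      have : n ≤ n * d := Nat.le_mul_of_pos_right _ hd
      have : n * d = h * d + d := by rw [hn]; ring
      have : h ≤ h * d := Nat.le_mul_of_pos_right _ hd
      omega
    exact Nat.le_of_mul_le_mul_left this (by omega)
  obtain ⟨w, rfl⟩ : ∃ w, N = k + w := ⟨N - k, by omega⟩
  set B : Finset (Submodule F (Fin (k + w) → F)) := A.toFinite.toFinset with hB
  have hmem : ∀ S, S ∈ B ↔ S ∈ A := fun S => by simp [hB]
  have hBdim : ∀ S ∈ B, finrank F S = h + d := fun S hS => hAdim S ((hmem S).1 hS)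
  have hspread := card_partialSpread_mul_le B hBdim fun S hS T hT =>
    hAint S ((hmem S).1 hS) T ((hmem T).1 hT)
  rw [finrank_fin_fun, hF] at hspread
  have hG := pow_sq_le_four_mul_prod_pow_sub_pow hq2 n
  set G := ∏ i : Fin n, (q ^ n - q ^ (i : ℕ))
  have hBq : #B * q ^ (h + d) ≤ 2 * q ^ (k + w) := by
    have h2 : 2 ≤ q ^ (h + d) := hq2.trans (Nat.le_self_pow (by omega) q)
    have : q ^ (h + d) ≤ 2 * (q ^ (h + d) - 1) := by omega
    calc #B * q ^ (h + d) ≤ #B * (2 * (q ^ (h + d) - 1)) := Nat.mul_le_mul_left _ this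
      _ = 2 * (#B * (q ^ (h + d) - 1)) := by ring
      _ ≤ _ := Nat.mul_le_mul_left _ hspread
  have hlt : #B * (q ^ (h + d)) ^ n < G * q ^ (n * w) := by
    by_contra! hge
    have hexp : n + ((k + w) + (h + d) * n) ≤ n * n + n * w + (h + d) := by
      have e : n = h + 1 := hn
      rw [e] at hnk ⊢
      nlinarith
    have hchain : q ^ n * q ^ ((k + w) + (h + d) * n) ≤ 8 * q ^ ((k + w) + (h + d) * n) :=
      calc q ^ n * q ^ ((k + w) + (h + d) * n)
          ≤ q ^ (n * n + n * w + (h + d)) := by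
            rw [← pow_add]; exact Nat.pow_le_pow_right (by omega) hexp
        _ = q ^ (n * n) * (q ^ (n * w) * q ^ (h + d)) := by ring
        _ ≤ 4 * G * (q ^ (n * w) * q ^ (h + d)) := Nat.mul_le_mul_right _ hG
        _ = 4 * q ^ (h + d) * (G * q ^ (n * w)) := by ring
        _ ≤ 4 * q ^ (h + d) * (#B * (q ^ (h + d)) ^ n) := Nat.mul_le_mul_left _ hge
        _ = 4 * (q ^ (h + d)) ^ n * (#B * q ^ (h + d)) := by ring
        _ ≤ 4 * (q ^ (h + d)) ^ n * (2 * q ^ (k + w)) := Nat.mul_le_mul_left _ hBq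
        _ = _ := by rw [pow_add q (k + w), pow_mul]; ring
    have := Nat.le_of_mul_le_mul_right hchain (by positivity)
    omega
  obtain ⟨f, hf⟩ := exists_linearMap_finrank_ker_inf_lt (W := Fin w → F) (n := n) B hBdim
    (by rw [hF, finrank_fin_fun]; exact hlt)
  have hker : k ≤ finrank F (LinearMap.ker f) := by
    have h1 := LinearMap.finrank_range_add_finrank_ker f
    have h2 := Submodule.finrank_le (LinearMap.range f)
    rw [finrank_fin_fun] at h1 h2
    omega
  obtain ⟨v, hv⟩ := exists_linearIndependent_of_le_finrank hker
  have hv' := hv.map' (Submodule.subtype _) (Submodule.ker_subtype _)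
  obtain ⟨U, hU, hUk⟩ : ∃ U ≤ LinearMap.ker f, finrank F U = k := by
    refine ⟨_, ?_, (finrank_span_eq_card hv').trans (Fintype.card_fin k)⟩
    exact Submodule.span_le.2 (Set.range_subset_iff.2 fun i => (v i).2)
  refine ⟨U, hUk, fun S hS => Nat.lt_succ_iff.1 ?_⟩
  exact (Submodule.finrank_mono (inf_le_inf_right S hU)).trans_lt (hf S ((hmem S).2 hS))
end

section
/- Let q be a prime power, let m ≤ m' be positive integers, and let C ⊆ F_q^{m×m'} be a rank-metric code with |C| ≥ 2 whose minimum distance equals m. Then for every integer 0 ≤ h ≤ m the following are equivalent: (i) there exists an m-dimensional F_q-subspace U of X = F_q^m × F_q^{m'} with U ∩ S_∞ = {0} that is (A_C,h)-scattered; (ii) there exists Y ∈ F_q^{m×m'} such that rank(A−Y) ≥ m−h for all A ∈ C; (iii) the covering radius ρ(C) is at least m−h. Moreover, ρ(C) = m − min{h ∈ ℕ : there exists an m-dimensional F_q-subspace U ≤ X with U ∩ S_∞ = {0} that is (A_C,h)-scattered}. -/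
theorem finrank_graph_inf_graph_add_rank {F : Type*} [Field F] {m n : ℕ}
    (A Y : Matrix (Fin m) (Fin n) F) :
    Module.finrank F ↥(LinearMap.graph Y.vecMulLinear ⊓ LinearMap.graph A.vecMulLinear)
      + (A - Y).rank = m := by
  have hmap : LinearMap.graph Y.vecMulLinear ⊓ LinearMap.graph A.vecMulLinear =
      (LinearMap.ker (A - Y).vecMulLinear).map (LinearMap.id.prod Y.vecMulLinear) := by
    ext ⟨x, y⟩
    simp only [Submodule.mem_inf, LinearMap.mem_graph_iff, Submodule.mem_map, LinearMap.mem_ker,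
      Matrix.vecMulLinear_apply, LinearMap.prod_apply, Function.prod, LinearMap.id_apply, Prod.mk.injEq,
      Matrix.vecMul_sub, sub_eq_zero]
    constructor
    · rintro ⟨h₁, h₂⟩
      exact ⟨x, h₂ ▸ h₁, rfl, h₁.symm⟩
    · rintro ⟨z, h, rfl, rfl⟩
      exact ⟨rfl, h.symm⟩
  have hinj : Function.Injective (LinearMap.id.prod Y.vecMulLinear) :=
    fun a b h => congrArg Prod.fst h
  have hrank : (A - Y).rank = Module.finrank F (LinearMap.range (A - Y).vecMulLinear) := by
    rw [← Matrix.rank_transpose, Matrix.rank, Matrix.mulVecLin_transpose]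
  rw [hmap, ← (Submodule.equivMapOfInjective _ hinj _).finrank_eq, hrank, add_comm,
    LinearMap.finrank_range_add_finrank_ker, Module.finrank_fin_fun]

theorem finrank_graph_vecMulLinear {F : Type*} [Field F] {m n : ℕ}
    (Y : Matrix (Fin m) (Fin n) F) :
    Module.finrank F ↥(LinearMap.graph Y.vecMulLinear) = m := by
  have h := finrank_graph_inf_graph_add_rank Y Y
  rwa [inf_idem, sub_self, Matrix.rank_zero, add_zero] at h

theorem graph_inf_prod_bot_top {R M N : Type*} [Ring R] [AddCommGroup M] [AddCommGroup N]
    [Module R M] [Module R N] (f : M →ₗ[R] N) :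
    LinearMap.graph f ⊓ Submodule.prod ⊥ ⊤ = ⊥ := by
  rw [eq_bot_iff]
  rintro ⟨x, y⟩ ⟨hxy, hx, -⟩
  obtain rfl : x = 0 := by simpa using hx
  obtain rfl : y = 0 := by simpa [LinearMap.mem_graph_iff] using hxy
  exact Submodule.zero_mem _

theorem exists_eq_graph_vecMulLinear {F : Type*} [Field F] {m n : ℕ}
    (U : Submodule F ((Fin m → F) × (Fin n → F))) (hU : Module.finrank F U = m)
    (hinf : U ⊓ Submodule.prod ⊥ ⊤ = ⊥) :
    ∃ Y : Matrix (Fin m) (Fin n) F, U = LinearMap.graph Y.vecMulLinear := by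
  let p : U →ₗ[F] (Fin m → F) := LinearMap.fst F _ _ ∘ₗ U.subtype
  have hp : Function.Injective p := by
    rw [← LinearMap.ker_eq_bot, eq_bot_iff]
    intro u hu
    have : (u : (Fin m → F) × (Fin n → F)) ∈ U ⊓ Submodule.prod ⊥ ⊤ :=
      ⟨u.2, hu, Submodule.mem_top⟩
    rw [hinf] at this
    exact Subtype.ext this
  let e := LinearEquiv.ofInjectiveOfFinrankEq p hp (by rw [hU, Module.finrank_fin_fun])
  let f : (Fin m → F) →ₗ[F] (Fin n → F) := LinearMap.snd F _ _ ∘ₗ U.subtype ∘ₗ e.symm.toLinearMap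
  have hf : (LinearMap.toMatrix' f).transpose.vecMulLinear = f := by
    rw [← Matrix.mulVecLin_transpose, Matrix.transpose_transpose]
    exact Matrix.toLin'_toMatrix' f
  refine ⟨(LinearMap.toMatrix' f).transpose, ?_⟩
  rw [hf]
  refine Submodule.eq_of_le_of_finrank_eq (fun u hu => ?_) ?_
  · have hs : e.symm u.1 = ⟨u, hu⟩ := by
      rw [LinearEquiv.symm_apply_eq]
      rfl
    rw [LinearMap.mem_graph_iff]
    simp [f, hs]
  · rw [hU, ← hf, finrank_graph_vecMulLinear]


/-- For a rank-metric code `C ⊆ F_q^(m×m')` with minimum distance `m`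
and `0 ≤ h ≤ m`: (i) the existence of an `m`-dimensional `(A_C,h)`-scattered subspace
meeting `S_∞` trivially, (ii) the existence of `Y` with `rank(A−Y) ≥ m−h` for all
`A ∈ C`, and (iii) `ρ(C) ≥ m−h` are equivalent; moreover
`ρ(C) = m − min{h : ∃ such a scattered subspace}`. -/
theorem stmt_14 (q m m' : ℕ) (hq : IsPrimePow q) (hm : 0 < m) (hmm' : m ≤ m')
    (F : Type) [Field F] [Fintype F] (hF : Fintype.card F = q)
    (C : Set (Matrix (Fin m) (Fin m') F)) (hC2 : 2 ≤ Set.ncard C)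
    (hmin : sInf {d : ℕ | ∃ A ∈ C, ∃ B ∈ C, A ≠ B ∧ (A - B).rank = d} = m) :
    let X := (Fin m → F) × (Fin m' → F)
    let Sinf : Submodule F X := Submodule.prod ⊥ ⊤
    let SA : Matrix (Fin m) (Fin m') F → Submodule F X := fun A => LinearMap.graph A.vecMulLinear
    let rho : ℕ := sSup {r : ℕ | ∃ Y : Matrix (Fin m) (Fin m') F,
      r = sInf {d : ℕ | ∃ A ∈ C, d = (A - Y).rank}}
    (∀ h : ℕ, h ≤ m →
      (((∃ U : Submodule F X, Module.finrank F U = m ∧ U ⊓ Sinf = ⊥ ∧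
          ∀ A ∈ C, Module.finrank F ↥(U ⊓ SA A) ≤ h) ↔
        (∃ Y : Matrix (Fin m) (Fin m') F, ∀ A ∈ C, m - h ≤ (A - Y).rank)) ∧
       ((∃ Y : Matrix (Fin m) (Fin m') F, ∀ A ∈ C, m - h ≤ (A - Y).rank) ↔
        m - h ≤ rho))) ∧
    rho = m - sInf {h : ℕ | ∃ U : Submodule F X, Module.finrank F U = m ∧
      U ⊓ Sinf = ⊥ ∧ ∀ A ∈ C, Module.finrank F ↥(U ⊓ SA A) ≤ h} := by
  intro X Sinf SA rho
  have hscat : ∀ h : ℕ, ((∃ U : Submodule F X, Module.finrank F U = m ∧ U ⊓ Sinf = ⊥ ∧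
      ∀ A ∈ C, Module.finrank F ↥(U ⊓ SA A) ≤ h) ↔
        ∃ Y : Matrix (Fin m) (Fin m') F, ∀ A ∈ C, m - h ≤ (A - Y).rank) := by
    intro h
    constructor
    · rintro ⟨U, hU, hinf, hS⟩
      obtain ⟨Y, rfl⟩ := exists_eq_graph_vecMulLinear U hU hinf
      refine ⟨Y, fun A hA => ?_⟩
      have h₁ := finrank_graph_inf_graph_add_rank A Y
      have h₂ : Module.finrank F
          ↥(LinearMap.graph Y.vecMulLinear ⊓ LinearMap.graph A.vecMulLinear) ≤ h := hS A hA
      omega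
    · rintro ⟨Y, hY⟩
      refine ⟨LinearMap.graph Y.vecMulLinear, finrank_graph_vecMulLinear Y,
        graph_inf_prod_bot_top _, fun A hA => ?_⟩
      have h₁ := finrank_graph_inf_graph_add_rank A Y
      have h₂ := hY A hA
      change Module.finrank F
        ↥(LinearMap.graph Y.vecMulLinear ⊓ LinearMap.graph A.vecMulLinear) ≤ h
      omega
  obtain ⟨A₀, hA₀⟩ : C.Nonempty := Set.nonempty_of_ncard_ne_zero (by omega)
  let R : Set ℕ := {r : ℕ | ∃ Y : Matrix (Fin m) (Fin m') F,
      r = sInf {d : ℕ | ∃ A ∈ C, d = (A - Y).rank}}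
  have hne : ∀ Y : Matrix (Fin m) (Fin m') F,
      {d : ℕ | ∃ A ∈ C, d = (A - Y).rank}.Nonempty := fun _ => ⟨_, A₀, hA₀, rfl⟩
  have hdist : ∀ Y : Matrix (Fin m) (Fin m') F, ∀ A ∈ C,
      sInf {d : ℕ | ∃ A ∈ C, d = (A - Y).rank} ≤ (A - Y).rank :=
    fun _ A hA => Nat.sInf_le ⟨A, hA, rfl⟩
  have hRle : ∀ r ∈ R, r ≤ m := by
    rintro r ⟨Y, rfl⟩
    refine (hdist Y A₀ hA₀).trans ?_
    have := finrank_graph_inf_graph_add_rank A₀ Y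
    omega
  have hrho : rho ∈ R := Nat.sSup_mem (s := R) ⟨_, 0, rfl⟩ ⟨m, hRle⟩
  have hcov : ∀ k : ℕ, (∃ Y : Matrix (Fin m) (Fin m') F, ∀ A ∈ C, k ≤ (A - Y).rank) ↔
      k ≤ rho := by
    intro k
    constructor
    · rintro ⟨Y, hY⟩
      have hle : sInf {d : ℕ | ∃ A ∈ C, d = (A - Y).rank} ≤ rho :=
        le_csSup (show BddAbove R from ⟨m, hRle⟩) ⟨Y, rfl⟩
      refine le_trans (le_csInf (hne Y) ?_) hle
      rintro d ⟨A, hA, rfl⟩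
      exact hY A hA
    · intro hk
      obtain ⟨Y, hY⟩ := hrho
      exact ⟨Y, fun A hA => (hk.trans_eq hY).trans (hdist Y A hA)⟩
  refine ⟨fun h _ => ⟨hscat h, hcov (m - h)⟩, ?_⟩
  let H : Set ℕ := {h : ℕ | ∃ U : Submodule F X, Module.finrank F U = m ∧
      U ⊓ Sinf = ⊥ ∧ ∀ A ∈ C, Module.finrank F ↥(U ⊓ SA A) ≤ h}
  have hH : ∀ h, h ∈ H ↔ m - h ≤ rho := fun h => (hscat h).trans (hcov (m - h))
  have hle : rho ≤ m := hRle rho hrho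
  have hmem : m - rho ∈ H := (hH _).2 (by omega)
  have h₁ : sInf H ≤ m - rho := Nat.sInf_le hmem
  have h₂ : m - sInf H ≤ rho := (hH _).1 (Nat.sInf_mem ⟨_, hmem⟩)
  change rho = m - sInf H
  omega
end

section
/- Let q be a prime power, let m ≤ m' be positive integers, set N = m+m', and let h be an integer with 0 ≤ h ≤ m−1. Let S_∞ be a fixed m'-dimensional F_q-subspace of F_q^N, and let A be a partial m-spread of F_q^N each of whose members intersects S_∞ trivially. If 4·|A| < q^{(h+1)(m'−m+h+1)}, then there exists an m-dimensional (A,h)-scattered F_q-subspace U of F_q^N with U ∩ S_∞ = {0}. -/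
open Module

/-- The partial products of `∏ (1 - q⁻ʲ)` are at least `1 / 4`, in the form that counts the
ordered bases of a `k`-dimensional space. -/
lemma pow_mul_self_le_four_mul_prod_pow_sub {q : ℕ} (hq : 2 ≤ q) (k : ℕ) :
    q ^ (k * k) ≤ 4 * ∏ i : Fin k, (q ^ k - q ^ (i : ℕ)) := by
  have hq0 : (0 : ℝ) < q := by exact_mod_cast (by omega : 0 < q)
  have key : ∀ k : ℕ, (1 / 4 : ℝ) + (1 / 2) ^ (k + 2) ≤
      ∏ j ∈ Finset.range (k + 1), (1 - (1 / (q : ℝ)) ^ (j + 1)) := by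
    have hx : ∀ j : ℕ, (1 - (1 / 2 : ℝ) ^ j) ≤ 1 - (1 / (q : ℝ)) ^ j := by
      intro j
      have hq2 : (2 : ℝ) ≤ q := by exact_mod_cast hq
      gcongr
    intro k
    induction k with
    | zero =>
      have := hx 1
      norm_num at this ⊢
      linarith
    | succ k ih =>
      rw [Finset.prod_range_succ]
      have hy : (1 / 2 : ℝ) ^ (k + 2) ≤ 1 / 4 := by
        calc (1 / 2 : ℝ) ^ (k + 2) ≤ (1 / 2) ^ 2 :=
              pow_le_pow_of_le_one (by norm_num) (by norm_num) (by omega)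
          _ = 1 / 4 := by norm_num
      have hy0 : (0 : ℝ) < (1 / 2) ^ (k + 2) := by positivity
      calc (1 / 4 : ℝ) + (1 / 2) ^ (k + 1 + 2)
          = 1 / 4 + (1 / 2) ^ (k + 2) / 2 := by ring
        _ ≤ (1 / 4 + (1 / 2) ^ (k + 2)) * (1 - (1 / 2) ^ (k + 2)) := by nlinarith
        _ ≤ _ := mul_le_mul ih (hx (k + 2)) (by linarith) (le_trans (by positivity) ih)
  rcases k with _ | k
  · simp
  have hprod : ((∏ i : Fin (k + 1), (q ^ (k + 1) - q ^ (i : ℕ)) : ℕ) : ℝ) =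
      (q : ℝ) ^ ((k + 1) * (k + 1)) *
        ∏ j ∈ Finset.range (k + 1), (1 - (1 / (q : ℝ)) ^ (j + 1)) := by
    rw [Fin.prod_univ_eq_prod_range (fun i => q ^ (k + 1) - q ^ i) (k + 1), Nat.cast_prod,
      ← Finset.prod_range_reflect (fun j => 1 - (1 / (q : ℝ)) ^ (j + 1)), pow_mul]
    conv_rhs => rw [← Finset.card_range (k + 1), ← Finset.prod_const, Finset.card_range,
      ← Finset.prod_mul_distrib]
    refine Finset.prod_congr rfl fun i hi => ?_
    have hi' : i < k + 1 := Finset.mem_range.mp hi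
    rw [Nat.cast_sub (Nat.pow_le_pow_right (by omega) hi'.le)]
    obtain ⟨t, rfl⟩ : ∃ t, k = i + t := ⟨k - i, by omega⟩
    have : i + t + 1 - 1 - i + 1 = t + 1 := by omega
    rw [this]
    push_cast
    have hsplit : (q : ℝ) ^ (i + t + 1) * (1 / (q : ℝ)) ^ (t + 1) = q ^ i := by
      rw [add_assoc, pow_add, mul_assoc, ← mul_pow, mul_one_div_cancel hq0.ne', one_pow, mul_one]
    rw [mul_sub, mul_one, hsplit]
  have h4 : (1 / 4 : ℝ) ≤ ∏ j ∈ Finset.range (k + 1), (1 - (1 / (q : ℝ)) ^ (j + 1)) :=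
    le_trans (by linarith [show (0 : ℝ) < (1 / 2) ^ (k + 2) by positivity]) (key k)
  have : ((q ^ ((k + 1) * (k + 1)) : ℕ) : ℝ) ≤
      ((4 * ∏ i : Fin (k + 1), (q ^ (k + 1) - q ^ (i : ℕ)) : ℕ) : ℝ) := by
    rw [Nat.cast_mul, hprod]
    push_cast
    nlinarith [show (0 : ℝ) < (q : ℝ) ^ ((k + 1) * (k + 1)) by positivity]
  exact_mod_cast this

section Counting

variable {F V W : Type*} [Field F] [Fintype F] [AddCommGroup V] [Module F V] [Module.Finite F V]
  [AddCommGroup W] [Module F W] [Module.Finite F W]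

/-- At most `q ^ (dim W * (dim V - dim p))` linear maps `V → W` vanish on the subspace `p`. -/
lemma card_linearMap_vanishing_le (p : Submodule F V) :
    Nat.card {g : V →ₗ[F] W // p ≤ LinearMap.ker g} ≤
      Fintype.card F ^ ((finrank F V - finrank F p) * finrank F W) := by
  have : Finite (V ⧸ p →ₗ[F] W) := Module.finite_of_finite F
  have hinj : Function.Injective
      (fun g : {g : V →ₗ[F] W // p ≤ LinearMap.ker g} => p.liftQ g.1 g.2) := by
    intro g g' hgg
    ext x
    simpa using LinearMap.congr_fun hgg (p.mkQ x)
  refine (Nat.card_le_card_of_injective _ hinj).trans_eq ?_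
  rw [Module.natCard_eq_pow_finrank (K := F), finrank_linearMap, Submodule.finrank_quotient,
    Nat.card_eq_fintype_card]

/-- The number of linear maps with kernel of dimension at least `k` is at most
`4 * q ^ ((dim V - k) * (dim W + k))`. -/
lemma card_linearMap_le_finrank_ker_le {k : ℕ} (hk : k ≤ finrank F V) :
    Nat.card {g : V →ₗ[F] W // k ≤ finrank F (LinearMap.ker g)} ≤
      4 * Fintype.card F ^ ((finrank F V - k) * (finrank F W + k)) := by
  classical
  set q := Fintype.card F with hqdef
  have hq : 2 ≤ q := Fintype.one_lt_card
  have : Finite (V →ₗ[F] W) := Module.finite_of_finite F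
  have : Finite V := Module.finite_of_finite F
  let G := {g : V →ₗ[F] W // k ≤ finrank F (LinearMap.ker g)}
  let B := {s : Fin k → V // LinearIndependent F s}
  have : Fintype G := Fintype.ofFinite _
  have : Fintype B := Fintype.ofFinite _
  have hlower : ∀ g : G, ∏ i : Fin k, (q ^ k - q ^ (i : ℕ)) ≤
      Nat.card {s : B // ∀ i, g.1 (s.1 i) = 0} := by
    intro g
    have hle : ∏ i : Fin k, (q ^ k - q ^ (i : ℕ)) ≤
        ∏ i : Fin k, (q ^ finrank F (LinearMap.ker g.1) - q ^ (i : ℕ)) :=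
      Finset.prod_le_prod' fun i _ =>
        Nat.sub_le_sub_right (Nat.pow_le_pow_right (by omega) g.2) _
    rw [← card_linearIndependent g.2] at hle
    refine hle.trans (Nat.card_le_card_of_injective
      (fun s => ⟨⟨fun i => (s.1 i : V), s.2.map' _ (Submodule.ker_subtype _)⟩,
        fun i => (s.1 i).2⟩) ?_)
    intro s s' hs
    exact Subtype.ext (funext fun i => Subtype.ext
      (congrFun (congrArg (fun x => x.1.1) hs) i))
  have hupper : ∀ s : B, Nat.card {g : G // ∀ i, g.1 (s.1 i) = 0} ≤
      q ^ ((finrank F V - k) * finrank F W) := by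
    intro s
    have hspan : finrank F (Submodule.span F (Set.range s.1)) = k := by
      simpa using finrank_span_eq_card s.2
    refine le_trans ?_ ((card_linearMap_vanishing_le (W := W)
      (Submodule.span F (Set.range s.1))).trans_eq (by rw [hspan]))
    refine Nat.card_le_card_of_injective
      (fun g => ⟨g.1.1, Submodule.span_le.mpr ?_⟩) ?_
    · rintro _ ⟨i, rfl⟩
      exact g.2 i
    · intro g g' hg
      simp only [Subtype.mk.injEq] at hg
      exact Subtype.ext (Subtype.ext hg)
  have hB : Nat.card B ≤ q ^ (finrank F V * k) := by
    rw [card_linearIndependent hk, pow_mul]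
    refine (Finset.prod_le_prod' fun i _ => Nat.sub_le _ _).trans_eq ?_
    simp [hqdef]
  have hdouble : Nat.card G * ∏ i : Fin k, (q ^ k - q ^ (i : ℕ)) ≤
      Nat.card B * q ^ ((finrank F V - k) * finrank F W) := by
    have e : (Σ g : G, {s : B // ∀ i, g.1 (s.1 i) = 0}) ≃
        (Σ s : B, {g : G // ∀ i, g.1 (s.1 i) = 0}) :=
      { toFun := fun x => ⟨x.2.1, x.1, x.2.2⟩
        invFun := fun x => ⟨x.2.1, x.1, x.2.2⟩
        left_inv := fun _ => rfl
        right_inv := fun _ => rfl }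
    have he := Nat.card_congr e
    rw [Nat.card_sigma, Nat.card_sigma] at he
    calc Nat.card G * ∏ i : Fin k, (q ^ k - q ^ (i : ℕ))
        = ∑ _g : G, ∏ i : Fin k, (q ^ k - q ^ (i : ℕ)) := by
          simp [Nat.card_eq_fintype_card]
      _ ≤ ∑ g : G, Nat.card {s : B // ∀ i, g.1 (s.1 i) = 0} :=
          Finset.sum_le_sum fun g _ => hlower g
      _ = _ := he
      _ ≤ ∑ _s : B, q ^ ((finrank F V - k) * finrank F W) :=
          Finset.sum_le_sum fun s _ => hupper s
      _ = _ := by simp [Nat.card_eq_fintype_card]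
  have hpow : 0 < q ^ (k * k) := by positivity
  refine Nat.le_of_mul_le_mul_right ?_ hpow
  obtain ⟨t, ht⟩ := Nat.exists_eq_add_of_le hk
  calc Nat.card G * q ^ (k * k)
      ≤ Nat.card G * (4 * ∏ i : Fin k, (q ^ k - q ^ (i : ℕ))) :=
        Nat.mul_le_mul_left _ (pow_mul_self_le_four_mul_prod_pow_sub hq k)
    _ = 4 * (Nat.card G * ∏ i : Fin k, (q ^ k - q ^ (i : ℕ))) := by ring
    _ ≤ 4 * (q ^ (finrank F V * k) * q ^ ((finrank F V - k) * finrank F W)) :=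
        Nat.mul_le_mul_left _ (hdouble.trans (Nat.mul_le_mul_right _ hB))
    _ = _ := by
        rw [ht, Nat.add_sub_cancel_left, mul_assoc, ← pow_add, ← pow_add]
        ring_nf

/-- A small set of linear maps admits a linear map `g` that is far from all of them in the
rank metric. -/
lemma exists_linearMap_finrank_ker_add_lt {k : ℕ} (hk : k ≤ finrank F V)
    (hVW : finrank F V ≤ finrank F W) {ι : Type*} [Finite ι] (f : ι → V →ₗ[F] W)
    (hcard : 4 * Nat.card ι < Fintype.card F ^ (k * (finrank F W - finrank F V + k))) :
    ∃ g : V →ₗ[F] W, ∀ i, finrank F (LinearMap.ker (g + f i)) < k := by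
  by_contra! hcon
  have : Finite (V →ₗ[F] W) := Module.finite_of_finite F
  choose c hc using hcon
  let G := {g : V →ₗ[F] W // k ≤ finrank F (LinearMap.ker g)}
  have hinj : Function.Injective
      (fun g : V →ₗ[F] W => ((c g, ⟨g + f (c g), hc g⟩) : ι × G)) := by
    intro g g' hgg
    have hc_eq : c g = c g' := congrArg Prod.fst hgg
    have hadd : g + f (c g) = g' + f (c g') := congrArg (fun x => x.2.1) hgg
    rw [hc_eq] at hadd
    exact add_right_cancel hadd
  have hle := Nat.card_le_card_of_injective _ hinj
  rw [Nat.card_prod, Module.natCard_eq_pow_finrank (K := F), finrank_linearMap,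
    Nat.card_eq_fintype_card] at hle
  have hG := card_linearMap_le_finrank_ker_le (W := W) hk
  refine absurd hle (not_le.mpr ?_)
  have hq : 0 < Fintype.card F := Fintype.card_pos
  obtain ⟨t, ht⟩ := Nat.exists_eq_add_of_le hk
  obtain ⟨r, hr⟩ := Nat.exists_eq_add_of_le hVW
  calc Nat.card ι * Nat.card G
      ≤ Nat.card ι * (4 * Fintype.card F ^ ((finrank F V - k) * (finrank F W + k))) :=
        Nat.mul_le_mul_left _ hG
    _ = 4 * Nat.card ι * Fintype.card F ^ ((finrank F V - k) * (finrank F W + k)) := by ring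
    _ < Fintype.card F ^ (k * (finrank F W - finrank F V + k)) *
          Fintype.card F ^ ((finrank F V - k) * (finrank F W + k)) :=
        Nat.mul_lt_mul_of_pos_right hcard (by positivity)
    _ = Fintype.card F ^ (finrank F V * finrank F W) := by
        rw [← pow_add, hr, Nat.add_sub_cancel_left, ht, Nat.add_sub_cancel_left]
        ring_nf

end Counting

/-- Let `m ≤ m'`, `0 ≤ h ≤ m-1`, and let `A` be a partial `m`-spread
of `F_q^(m+m')` all of whose members meet a fixed `m'`-dimensional subspace `S_∞`
trivially. If `4·|A| < q^((h+1)(m'−m+h+1))`, then there exists an `m`-dimensional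
`(A,h)`-scattered subspace of `F_q^(m+m')` meeting `S_∞` trivially. -/
theorem stmt_16 (q m m' h : ℕ) (hq : IsPrimePow q) (hm : 0 < m) (hmm' : m ≤ m')
    (hh : h ≤ m - 1)
    (F : Type) [Field F] [Fintype F] (hF : Fintype.card F = q)
    (Sinf : Submodule F (Fin (m + m') → F)) (hSinf : Module.finrank F Sinf = m')
    (A : Set (Submodule F (Fin (m + m') → F)))
    (hAdim : ∀ S ∈ A, Module.finrank F S = m)
    (hAint : ∀ S ∈ A, ∀ T ∈ A, S ≠ T → S ⊓ T = ⊥)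
    (hAS : ∀ S ∈ A, S ⊓ Sinf = ⊥)
    (hcard : 4 * Set.ncard A < q ^ ((h + 1) * (m' - m + h + 1))) :
    ∃ U : Submodule F (Fin (m + m') → F), Module.finrank F U = m ∧
      U ⊓ Sinf = ⊥ ∧ ∀ S ∈ A, Module.finrank F ↥(U ⊓ S) ≤ h := by
  have hcompl : ∀ S : A, IsCompl Sinf S.1 := fun S => by
    refine IsCompl.symm ((Submodule.isCompl_iff_disjoint _ _ ?_).mpr
      (disjoint_iff.mpr (hAS S S.2)))
    rw [hAdim S S.2, hSinf, Module.finrank_fin_fun]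
  obtain ⟨V, hV⟩ := Sinf.exists_isCompl
  have hVm : finrank F V = m := by
    have := Submodule.finrank_add_eq_of_isCompl hV
    rw [hSinf, Module.finrank_fin_fun] at this
    omega
  have : Finite (Submodule F (Fin (m + m') → F)) :=
    Finite.of_injective (fun p => (p : Set (Fin (m + m') → F))) SetLike.coe_injective
  obtain ⟨g, hg⟩ := exists_linearMap_finrank_ker_add_lt (F := F) (V := V) (W := Sinf)
    (k := h + 1) (by omega) (by omega)
    (fun S : A => (Sinf.projectionOnto S.1 (hcompl S)).comp V.subtype)
    (by rwa [hF, hSinf, hVm, Nat.card_coe_set_eq])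
  let φ : V →ₗ[F] (Fin (m + m') → F) := V.subtype + Sinf.subtype.comp g
  have hφ : ∀ x : V, φ x = x + g x := fun x => rfl
  have hmem : ∀ x : V, φ x ∈ Sinf → x = 0 := by
    intro x hx
    rw [hφ, Submodule.add_mem_iff_left _ (g x).2] at hx
    exact Subtype.ext (Submodule.disjoint_def.mp hV.disjoint _ hx x.2)
  have hinj : Function.Injective φ :=
    (injective_iff_map_eq_zero φ).mpr fun x hx => hmem x (hx ▸ Sinf.zero_mem)
  refine ⟨LinearMap.range φ, ?_, ?_, fun S hS => ?_⟩
  · rw [LinearMap.finrank_range_of_inj hinj, hVm]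
  · rw [eq_bot_iff]
    rintro _ ⟨⟨x, rfl⟩, hx⟩
    simp [hmem x hx]
  · refine le_trans (Submodule.finrank_mono ?_) ((Submodule.finrank_map_le φ _).trans
      (Nat.lt_succ_iff.mp (hg ⟨S, hS⟩)))
    rintro _ ⟨⟨x, rfl⟩, hx⟩
    refine ⟨x, ?_, rfl⟩
    have h0 : Sinf.projectionOnto S (hcompl ⟨S, hS⟩) (φ x) = 0 :=
      (Submodule.projectionOnto_apply_eq_zero_iff _).mpr hx
    rw [hφ, map_add, Submodule.projectionOnto_apply_left (hcompl ⟨S, hS⟩) (g x)] at h0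
    simpa [add_comm] using h0
end

section
/- Let q be a prime power, let m ≤ m' and s be positive integers, and let C ⊆ F_q^{m×m'} be a rank-metric code with |C| = q^s whose minimum distance equals m. Let h be the smallest nonnegative integer satisfying (h+1)² + (m'−m)(h+1) − (s + log_q 4) > 0 (an inequality of real numbers). Then the covering radius satisfies ρ(C) ≥ m − h (as integers). Moreover, if q ≥ 4, then ρ(C) ≥ m − √(s+1) (as real numbers). -/
open Module in
/-- A linearly independent family of size `k ≤ r ≤ dim V` can be enlarged to size `r`. -/
theorem exists_linearIndependent_span_le {K V : Type*} [Field K] [AddCommGroup V] [Module K V]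
    [FiniteDimensional K V] {k r : ℕ} (hkr : k ≤ r) (hr : r ≤ finrank K V) (v : Fin k → V)
    (hv : LinearIndependent K v) :
    ∃ w : Fin r → V, LinearIndependent K w ∧
      Submodule.span K (Set.range v) ≤ Submodule.span K (Set.range w) := by
  induction r, hkr using Nat.le_induction with
  | base => exact ⟨v, hv, le_rfl⟩
  | succ n hn ih =>
    obtain ⟨w, hw, hle⟩ := ih (by omega)
    obtain ⟨x, hx⟩ := exists_linearIndependent_snoc_of_lt_finrank hw (by omega)
    refine ⟨_, hx, hle.trans (Submodule.span_mono ?_)⟩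
    rintro _ ⟨i, rfl⟩
    exact ⟨i.castSucc, by simp⟩

theorem Matrix.natCard_fin_fin (K : Type*) [Fintype K] (m n : ℕ) :
    Nat.card (Matrix (Fin m) (Fin n) K) = Fintype.card K ^ (m * n) := by
  rw [Nat.card_congr (Matrix.of (m := Fin m) (n := Fin n) (α := K)).symm, Nat.card_fun,
    Nat.card_fun]
  simp only [Nat.card_eq_fintype_card, Fintype.card_fin]
  rw [← pow_mul, mul_comm]

open scoped Matrix in
/-- A matrix of rank at most `r` factors through `r` with a left-invertible left factor. -/
theorem Matrix.exists_leftInverse_mul_eq_of_rank_le {K : Type*} [Field K] {m n r : ℕ}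
    (hr : r ≤ m) (M : Matrix (Fin m) (Fin n) K) (hM : M.rank ≤ r) :
    ∃ (A : Matrix (Fin m) (Fin r) K) (B : Matrix (Fin r) (Fin n) K)
      (L : Matrix (Fin r) (Fin m) K), L * A = 1 ∧ A * B = M := by
  let b := Module.finBasis K (LinearMap.range M.mulVecLin)
  obtain ⟨w, hw, hle⟩ := exists_linearIndependent_span_le (K := K) (V := Fin m → K)
    (v := fun i => (b i : Fin m → K)) hM (by simpa using hr)
    (b.linearIndependent.map' (Submodule.subtype _) (Submodule.ker_subtype _))
  have hspan : LinearMap.range M.mulVecLin ≤ Submodule.span K (Set.range w) := by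
    refine le_trans (le_of_eq ?_) hle
    have := congrArg (Submodule.map (Submodule.subtype (LinearMap.range M.mulVecLin))) b.span_eq
    rw [Submodule.map_span, Submodule.map_subtype_top, ← Set.range_comp] at this
    exact this.symm
  have hA : (Matrix.of w)ᵀ.col = w := rfl
  obtain ⟨g, hg⟩ := (Matrix.mulVecLin (Matrix.of w)ᵀ).exists_leftInverse_of_injective
    (LinearMap.ker_eq_bot.2 (Matrix.mulVec_injective_iff.2 (hA ▸ hw)))
  obtain ⟨L, rfl⟩ := Matrix.toLin'.surjective g
  have hL : L * (Matrix.of w)ᵀ = 1 := Matrix.toLin'.injective <| by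
    rw [Matrix.toLin'_mul, Matrix.toLin'_one]
    exact hg
  have hcol : ∀ j, ∃ x, (Matrix.of w)ᵀ.mulVec x = M.col j := fun j => by
    have hj : M.col j ∈ LinearMap.range M.mulVecLin :=
      ⟨Pi.single j 1, by simp⟩
    have := hspan hj
    rw [← hA, ← Matrix.range_mulVecLin] at this
    exact this
  choose x hx using hcol
  refine ⟨(Matrix.of w)ᵀ, (Matrix.of x)ᵀ, L, hL, ?_⟩
  ext i j
  exact congrFun (hx j) i

/-- Double counting of the factorizations of matrices of rank at most `r`. -/
theorem Matrix.card_rank_le_mul_card_GL_le {K : Type*} [Field K] [Fintype K] {m n r : ℕ}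
    (hr : r ≤ m) :
    Nat.card {M : Matrix (Fin m) (Fin n) K // M.rank ≤ r} * Nat.card (GL (Fin r) K) ≤
      Fintype.card K ^ (r * (m + n)) := by
  classical
  choose A B L hL hAB using fun M : {M : Matrix (Fin m) (Fin n) K // M.rank ≤ r} =>
    M.1.exists_leftInverse_mul_eq_of_rank_le hr M.2
  let f : {M : Matrix (Fin m) (Fin n) K // M.rank ≤ r} × GL (Fin r) K →
      Matrix (Fin m) (Fin r) K × Matrix (Fin r) (Fin n) K :=
    fun p => (A p.1 * (p.2 : Matrix (Fin r) (Fin r) K),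
      ((p.2⁻¹ : GL (Fin r) K) : Matrix (Fin r) (Fin r) K) * B p.1)
  have hprod : ∀ p, (f p).1 * (f p).2 = p.1.1 := fun p => by
    change A p.1 * (p.2 : Matrix (Fin r) (Fin r) K) *
      (((p.2⁻¹ : GL (Fin r) K) : Matrix (Fin r) (Fin r) K) * B p.1) = _
    rw [Matrix.mul_assoc, ← Matrix.mul_assoc _ _ (B p.1), ← Units.val_mul, mul_inv_cancel,
      Units.val_one, Matrix.one_mul, hAB]
  have hf : Function.Injective f := by
    rintro ⟨M, G⟩ ⟨N, H⟩ h
    have hMN : M = N := Subtype.ext <| by rw [← hprod (M, G), ← hprod (N, H), h]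
    subst hMN
    have h1 : A M * (G : Matrix (Fin r) (Fin r) K) = A M * (H : Matrix (Fin r) (Fin r) K) :=
      congrArg Prod.fst h
    have h2 := congrArg (L M * ·) h1
    simp only [← Matrix.mul_assoc, hL, Matrix.one_mul] at h2
    rw [Units.ext h2]
  have := Nat.card_le_card_of_injective f hf
  refine (Nat.card_prod _ _).symm.le.trans (this.trans (le_of_eq ?_))
  rw [Nat.card_prod, Matrix.natCard_fin_fin, Matrix.natCard_fin_fin]
  ring

/-- `∏_{i < r} (1 - q^{-(i+1)}) ≥ 1/4` for `q ≥ 2`, in a form strengthened for induction. -/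
theorem quarter_add_le_prod_one_sub_inv_pow {x : ℝ} (hx0 : 0 ≤ x) (hx : x ≤ 1 / 2) {r : ℕ}
    (hr : 1 ≤ r) :
    1 / 4 + (1 / 2 : ℝ) ^ (r + 1) ≤ ∏ i ∈ Finset.range r, (1 - x ^ (i + 1)) := by
  induction r, hr using Nat.le_induction with
  | base => norm_num; linarith
  | succ n hn ih =>
    rw [Finset.prod_range_succ]
    have hy : (1 / 2 : ℝ) ^ n ≤ 1 / 2 := by
      simpa using pow_le_pow_of_le_one (by norm_num : (0 : ℝ) ≤ 1 / 2) (by norm_num) hn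
    have hy0 : (0 : ℝ) ≤ (1 / 2) ^ n := by positivity
    have hxy : x ^ (n + 1) ≤ (1 / 2 : ℝ) ^ (n + 1) := pow_le_pow_left₀ hx0 hx _
    have h1 : 0 ≤ 1 - x ^ (n + 1) := by
      rw [pow_succ (1 / 2 : ℝ)] at hxy; linarith
    refine le_trans ?_ (mul_le_mul_of_nonneg_right ih h1)
    refine le_trans ?_ (mul_le_mul_of_nonneg_left (sub_le_sub_left hxy 1) (by positivity))
    simp only [pow_succ] at *
    nlinarith

/-- At least a quarter of all square matrices over a finite field are invertible. -/
theorem Matrix.card_le_four_mul_card_GL (K : Type*) [Field K] [Fintype K] (r : ℕ) :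
    (Fintype.card K : ℝ) ^ (r * r) ≤ 4 * Nat.card (GL (Fin r) K) := by
  have hq : 2 ≤ Fintype.card K := Fintype.one_lt_card
  have hq' : (2 : ℝ) ≤ Fintype.card K := by exact_mod_cast hq
  rw [Matrix.card_GL_field]
  generalize Fintype.card K = q at *
  have hq0 : (q : ℝ) ≠ 0 := by positivity
  have hprod : ((∏ i : Fin r, (q ^ r - q ^ (i : ℕ)) : ℕ) : ℝ) =
      q ^ (r * r) * ∏ i ∈ Finset.range r, (1 - ((q : ℝ)⁻¹) ^ (i + 1)) := by
    rw [Fin.prod_univ_eq_prod_range (fun i => q ^ r - q ^ i) r, ← Finset.prod_range_reflect,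
      pow_mul, Nat.cast_prod]
    have hconst : ((q : ℝ) ^ r) ^ r = ∏ _i ∈ Finset.range r, (q : ℝ) ^ r := by simp
    rw [hconst, ← Finset.prod_mul_distrib]
    refine Finset.prod_congr rfl fun i hi => ?_
    have hi := Finset.mem_range.1 hi
    rw [Nat.cast_sub (Nat.pow_le_pow_right (by omega) (by omega)), mul_sub, mul_one, inv_pow,
      ← div_eq_mul_inv]
    push_cast
    congr 1
    rw [eq_div_iff (by positivity), ← pow_add]
    congr 1
    omega
  have hq2 : 1 / 4 ≤ ∏ i ∈ Finset.range r, (1 - ((q : ℝ)⁻¹) ^ (i + 1)) := by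
    rcases Nat.eq_zero_or_pos r with rfl | hr
    · norm_num
    · refine le_trans ?_ (quarter_add_le_prod_one_sub_inv_pow (by positivity) ?_ hr)
      · simp
      · rw [one_div]; gcongr
  rw [hprod]
  have : (0 : ℝ) ≤ q ^ (r * r) := by positivity
  nlinarith

/-- Volume bound for balls in the rank metric. -/
theorem Matrix.card_rank_le_le {K : Type*} [Field K] [Fintype K] {m n r : ℕ} (hr : r ≤ m)
    (hmn : m ≤ n) :
    (Nat.card {M : Matrix (Fin m) (Fin n) K // M.rank ≤ r} : ℝ) *
      (Fintype.card K : ℝ) ^ ((m - r) * (n - r)) ≤ 4 * (Fintype.card K : ℝ) ^ (m * n) := by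
  have h1 : (Nat.card {M : Matrix (Fin m) (Fin n) K // M.rank ≤ r} : ℝ) *
      Nat.card (GL (Fin r) K) ≤ (Fintype.card K : ℝ) ^ (r * (m + n)) := by
    exact_mod_cast Matrix.card_rank_le_mul_card_GL_le (K := K) (n := n) hr
  have h2 := Matrix.card_le_four_mul_card_GL K r
  have hq : (0 : ℝ) < Fintype.card K := by exact_mod_cast Fintype.card_pos
  generalize (Fintype.card K : ℝ) = q at *
  generalize (Nat.card {M : Matrix (Fin m) (Fin n) K // M.rank ≤ r} : ℝ) = N at *
  have hN : N * q ^ (r * r) ≤ 4 * q ^ (r * (m + n)) := by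
    by_cases hN : 0 ≤ N
    · nlinarith [mul_le_mul_of_nonneg_left h2 hN]
    · have : 0 < q ^ (r * r) := by positivity
      have : 0 < q ^ (r * (m + n)) := by positivity
      nlinarith
  obtain ⟨a, rfl⟩ := Nat.exists_eq_add_of_le hr
  obtain ⟨b, rfl⟩ := Nat.exists_eq_add_of_le (hr.trans hmn)
  rw [Nat.add_sub_cancel_left, Nat.add_sub_cancel_left]
  refine le_of_mul_le_mul_right ?_ (pow_pos hq (r * (r + a + (r + b))))
  calc N * q ^ (a * b) * q ^ (r * (r + a + (r + b)))
      = N * q ^ (r * r) * q ^ ((r + a) * (r + b)) := by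
        rw [mul_assoc, mul_assoc, ← pow_add, ← pow_add]; ring_nf
    _ ≤ 4 * q ^ (r * (r + a + (r + b))) * q ^ ((r + a) * (r + b)) := by gcongr
    _ = _ := by ring

/-- The sphere-covering bound for rank-metric codes. -/
theorem Matrix.card_le_ncard_mul_card_rank_le {K : Type*} [Field K] [Fintype K] {m n r : ℕ}
    (C : Set (Matrix (Fin m) (Fin n) K))
    (hC : ∀ Y : Matrix (Fin m) (Fin n) K, ∃ A ∈ C, (A - Y).rank ≤ r) :
    Fintype.card K ^ (m * n) ≤
      C.ncard * Nat.card {M : Matrix (Fin m) (Fin n) K // M.rank ≤ r} := by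
  classical
  choose A hA hr using hC
  have := Nat.card_le_card_of_injective
    (fun Y => ((⟨A Y, hA Y⟩ : C),
      (⟨A Y - Y, hr Y⟩ : {M : Matrix (Fin m) (Fin n) K // M.rank ≤ r})))
    (fun Y Z h => by
      simp only [Prod.mk.injEq, Subtype.mk.injEq] at h
      simpa [h.1] using h.2)
  rw [Nat.card_prod, Nat.card_coe_set_eq] at this
  rwa [Matrix.natCard_fin_fin] at this

/-- Let `C ⊆ F_q^(m×m')` (with `m ≤ m'`) be a rank-metric code of size
`q^s` and minimum distance `m`, and let `h` be the smallest nonnegative integer with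
`(h+1)² + (m'−m)(h+1) − (s + log_q 4) > 0`. Then the covering radius satisfies
`ρ(C) ≥ m − h` (as integers), and if `q ≥ 4` then `ρ(C) ≥ m − √(s+1)` (as reals). -/
theorem stmt_17 (q m m' s : ℕ) (hq : IsPrimePow q) (hm : 0 < m) (hmm' : m ≤ m')
    (hs : 0 < s)
    (F : Type) [Field F] [Fintype F] (hF : Fintype.card F = q)
    (C : Set (Matrix (Fin m) (Fin m') F)) (hCcard : Set.ncard C = q ^ s)
    (hmin : sInf {d : ℕ | ∃ A ∈ C, ∃ B ∈ C, A ≠ B ∧ (A - B).rank = d} = m)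
    (h : ℕ)
    (hleast : IsLeast {h : ℕ |
      (s : ℝ) + Real.logb q 4 <
        ((h : ℝ) + 1) ^ 2 + ((m' : ℝ) - (m : ℝ)) * ((h : ℝ) + 1)} h) :
    let rho : ℕ := sSup {r : ℕ | ∃ Y : Matrix (Fin m) (Fin m') F,
      r = sInf {d : ℕ | ∃ A ∈ C, d = (A - Y).rank}}
    (m : ℤ) - (h : ℤ) ≤ (rho : ℤ) ∧
      (4 ≤ q → (m : ℝ) - Real.sqrt ((s : ℝ) + 1) ≤ (rho : ℝ)) := by
  intro rho
  have hq2 : 2 ≤ q := hq.two_le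
  have hq1 : (1 : ℝ) < q := by exact_mod_cast hq2
  have hq0 : (0 : ℝ) < q := by linarith
  have hCne : C.Nonempty := Set.nonempty_of_ncard_ne_zero (by rw [hCcard]; positivity)
  have hbdd : BddAbove {r : ℕ | ∃ Y : Matrix (Fin m) (Fin m') F,
      r = sInf {d : ℕ | ∃ A ∈ C, d = (A - Y).rank}} := by
    refine ⟨m, ?_⟩
    rintro _ ⟨Y, rfl⟩
    obtain ⟨A, hA⟩ := hCne
    exact (Nat.sInf_le (s := {d : ℕ | ∃ A ∈ C, d = (A - Y).rank}) ⟨A, hA, rfl⟩).trans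
      (Matrix.rank_le_height _)
  have hcover : ∀ Y : Matrix (Fin m) (Fin m') F, ∃ A ∈ C, (A - Y).rank ≤ rho := fun Y => by
    obtain ⟨A₀, hA₀⟩ := hCne
    obtain ⟨A, hA, hd⟩ := Nat.sInf_mem (s := {d : ℕ | ∃ A ∈ C, d = (A - Y).rank})
      ⟨_, A₀, hA₀, rfl⟩
    exact ⟨A, hA, hd ▸ le_csSup hbdd ⟨Y, rfl⟩⟩
  have key : ∀ r : ℕ, rho ≤ r → r ≤ m →
      ((m : ℝ) - r) * ((m' : ℝ) - r) ≤ s + Real.logb q 4 := fun r hr hrm => by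
    have h1 : (q : ℝ) ^ (m * m') ≤
        q ^ s * Nat.card {M : Matrix (Fin m) (Fin m') F // M.rank ≤ r} := by
      have h0 := Matrix.card_le_ncard_mul_card_rank_le C
        fun Y => (hcover Y).imp fun A hA => ⟨hA.1, hA.2.trans hr⟩
      rw [hF, hCcard] at h0
      exact_mod_cast h0
    have h2 := Matrix.card_rank_le_le (K := F) hrm hmm'
    rw [hF] at h2
    have h3 : (q : ℝ) ^ ((m - r) * (m' - r)) ≤ q ^ s * 4 := by
      refine le_of_mul_le_mul_left ?_ (pow_pos hq0 (m * m'))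
      calc (q : ℝ) ^ (m * m') * q ^ ((m - r) * (m' - r))
          ≤ q ^ s * Nat.card {M : Matrix (Fin m) (Fin m') F // M.rank ≤ r} *
            q ^ ((m - r) * (m' - r)) := by gcongr
        _ ≤ q ^ s * (4 * q ^ (m * m')) := by rw [mul_assoc]; gcongr
        _ = _ := by ring
    have h4 := Real.logb_le_logb_of_le hq1 (by positivity) h3
    rw [Real.logb_mul (by positivity) (by norm_num), Real.logb_pow, Real.logb_pow,
      Real.logb_self_eq_one hq1] at h4
    push_cast [Nat.cast_sub hrm, Nat.cast_sub (hrm.trans hmm')] at h4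
    linarith
  have hmm'R : (m : ℝ) ≤ m' := by exact_mod_cast hmm'
  refine ⟨?_, fun hq4 => ?_⟩
  · by_contra! hlt
    have hk := key (m - h - 1) (by omega) (by omega)
    have hcast : ((m - h - 1 : ℕ) : ℝ) = (m : ℝ) - h - 1 := by
      rw [Nat.sub_sub, Nat.cast_sub (by omega)]; push_cast; ring
    rw [hcast] at hk
    have : (s : ℝ) + Real.logb q 4 <
        ((h : ℝ) + 1) ^ 2 + ((m' : ℝ) - (m : ℝ)) * ((h : ℝ) + 1) := hleast.1
    nlinarith
  · rcases le_total m rho with hle | hle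
    · have : (m : ℝ) ≤ rho := by exact_mod_cast hle
      linarith [Real.sqrt_nonneg ((s : ℝ) + 1)]
    · have hk := key rho le_rfl hle
      have hle' : (rho : ℝ) ≤ m := by exact_mod_cast hle
      have hlog : Real.logb q 4 ≤ 1 := by
        rw [Real.logb_le_iff_le_rpow hq1 (by norm_num), Real.rpow_one]
        exact_mod_cast hq4
      have : (m : ℝ) - rho ≤ Real.sqrt ((s : ℝ) + 1) := Real.le_sqrt_of_sq_le (by nlinarith)
      linarith
end

section
/- Let q be a prime power, let m, n, h be positive integers with n ≥ 2, let X = F_{q^m}^n, regarded as an F_q-vector space of dimension mn, and let D = {⟨x⟩_{F_{q^m}} : x ∈ X \ {0}} be the Desarguesian m-spread of X. If U is a (D,h)-scattered F_q-subspace of X with dim_{F_q}(U) = (n−2)m + h + 1, then for every two-dimensional F_{q^m}-subspace W of X there exist nonzero vectors u, u' ∈ U ∩ W with ⟨u⟩_{F_{q^m}} ≠ ⟨u'⟩_{F_{q^m}}; in particular, the F_{q^m}-span of U ∩ W equals W, i.e. the linear set L_U = {⟨u⟩_{F_{q^m}} : u ∈ U \ {0}} is a linear 2-cutting blocking set in X.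 -/
/-- Grassmann's inequality for an `F`-subspace and an `E`-subspace of `Eⁿ`. -/
theorem finrank_add_le_finrank_inf_restrictScalars {F E ι : Type*} [Field F] [Field E]
    [Algebra F E] [Fintype ι] [FiniteDimensional F E]
    (U : Submodule F (ι → E)) (W : Submodule E (ι → E)) :
    Module.finrank F U + Module.finrank F E * Module.finrank E W ≤
      Module.finrank F ↥(U ⊓ W.restrictScalars F) + Fintype.card ι * Module.finrank F E := by
  have hW : Module.finrank F ↥(W.restrictScalars F) =
      Module.finrank F E * Module.finrank E W := (Module.finrank_mul_finrank F E W).symm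
  have hsum := Submodule.finrank_sup_add_finrank_inf_eq U (W.restrictScalars F)
  have hle := Submodule.finrank_le (U ⊔ W.restrictScalars F)
  rw [Module.finrank_pi_fintype, Finset.sum_const, Finset.card_univ, smul_eq_mul] at hle
  omega


/-- Let `X = F_{q^m}^n` (`n ≥ 2`) with Desarguesian `m`-spread `D`.
If `U` is a `(D,h)`-scattered `F_q`-subspace of `X` with `dim_{F_q} U = (n−2)m + h + 1`,
then every two-dimensional `F_{q^m}`-subspace `W` of `X` contains two nonzero vectors of
`U` with distinct `F_{q^m}`-spans; in particular the `F_{q^m}`-span of `U ∩ W` is `W`,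
i.e. the linear set `L_U` is a linear 2-cutting blocking set in `X`. -/
theorem stmt_18 (q m n h : ℕ) (hq : IsPrimePow q) (hm : 0 < m) (hn : 2 ≤ n)
    (hh : 0 < h)
    (F : Type) [Field F] [Fintype F] (hF : Fintype.card F = q)
    (E : Type) [Field E] [Algebra F E] (hE : Module.finrank F E = m)
    (U : Submodule F (Fin n → E))
    (hUdim : Module.finrank F U = (n - 2) * m + h + 1)
    (hUsc : ∀ x : Fin n → E, x ≠ 0 →
      Module.finrank F ↥(U ⊓ (Submodule.span E {x}).restrictScalars F) ≤ h) :
    ∀ W : Submodule E (Fin n → E), Module.finrank E W = 2 →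
      (∃ u u' : Fin n → E, u ∈ U ∧ u ∈ W ∧ u' ∈ U ∧ u' ∈ W ∧ u ≠ 0 ∧ u' ≠ 0 ∧
        Submodule.span E {u} ≠ Submodule.span E {u'}) ∧
      Submodule.span E ((U : Set (Fin n → E)) ∩ (W : Set (Fin n → E))) = W := by
  intro W hW
  have : FiniteDimensional F E := Module.finite_of_finrank_pos (by omega)
  have hinf : h + 1 ≤ Module.finrank F ↥(U ⊓ W.restrictScalars F) := by
    have hle := finrank_add_le_finrank_inf_restrictScalars U W
    rw [hUdim, hE, hW, Fintype.card_fin] at hle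
    obtain ⟨k, rfl⟩ := Nat.exists_eq_add_of_le hn
    rw [Nat.add_sub_cancel_left] at hle
    linarith
  have hescape : ∀ x : Fin n → E, x ≠ 0 → ∃ y ∈ U ⊓ W.restrictScalars F,
      y ∉ Submodule.span E {x} := by
    intro x hx
    by_contra! hall
    have hmono : U ⊓ W.restrictScalars F ≤ U ⊓ (Submodule.span E {x}).restrictScalars F :=
      fun y hy => ⟨hy.1, hall y hy⟩
    have hle := Submodule.finrank_mono hmono
    have hsc := hUsc x hx
    omega
  obtain ⟨u, hu, hu0⟩ : ∃ u ∈ U ⊓ W.restrictScalars F, u ≠ 0 := by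
    apply Submodule.exists_mem_ne_zero_of_ne_bot
    intro hbot
    rw [hbot, finrank_bot] at hinf
    omega
  obtain ⟨u', hu', hspan⟩ := hescape u hu0
  have hu'0 : u' ≠ 0 := by
    rintro rfl
    exact hspan (Submodule.zero_mem _)
  refine ⟨⟨u, u', hu.1, hu.2, hu'.1, hu'.2, hu0, hu'0, fun heq => hspan ?_⟩, ?_⟩
  · exact heq ▸ Submodule.mem_span_singleton_self u'
  · have hli : LinearIndependent E ![u, u'] :=
      (LinearIndependent.pair_iff' hu0).2 fun a ha =>
        hspan (Submodule.mem_span_singleton.2 ⟨a, ha⟩)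
    have hrange : Submodule.span E (Set.range ![u, u']) ≤
        Submodule.span E ((U : Set (Fin n → E)) ∩ (W : Set (Fin n → E))) := by
      apply Submodule.span_mono
      rintro _ ⟨i, rfl⟩
      fin_cases i
      · exact hu
      · exact hu'
    refine Submodule.eq_of_le_of_finrank_le
      (Submodule.span_le.2 Set.inter_subset_right) ?_
    have hcard := finrank_span_eq_card hli
    rw [hW]
    exact hcard.ge.trans (Submodule.finrank_mono hrange)
end
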